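/- (Main theorem, sufficiency of the characterisation.) Suppose κ is a skewon-free invertible medium tensor on ℝ⁴ such that: (a) the zero set of the Fresnel polynomial of κ contains no 2-dimensional linear subspace of ℝ⁴; and (b) there exist μ ∈ ℝ, λ > 0, ρ ∈ ℝ∖{0} and nonzero bivectors A, B with (κ + μ·Id)∘(κ + μ·Id) = −λ·Id + ρ(Ā⊗B) + ρ(B̄⊗A). Then there exist Lorentz metrics g₊, g₋ with N(g₊) ≠ N(g₋) such that the zero set of the Fresnel polynomial of κ equals N(g₊) ∪ N(g₋). -/

import Mathlib

noncomputable section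
open Matrix BigOperators

/-- Medium tensor components `κ^{ij}_{rs}` on ℝ⁴ (upper indices first). -/
abbrev MT := Fin 4 → Fin 4 → Fin 4 → Fin 4 → ℝ

/-- Bivector (or 2-form) components on ℝ⁴. -/
abbrev BV := Fin 4 → Fin 4 → ℝ

/-- Totally antisymmetric Levi-Civita symbol on {0,1,2,3} with ε₀₁₂₃ = 1. -/
def eps (i j k l : Fin 4) : ℝ :=
  ((j.val : ℝ) - i.val) * ((k.val : ℝ) - i.val) * ((l.val : ℝ) - i.val) *
    ((k.val : ℝ) - j.val) * ((l.val : ℝ) - j.val) * ((l.val : ℝ) - k.val) / 12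

/-- Identity medium tensor `Id^{ij}_{rs} = δ^i_r δ^j_s − δ^i_s δ^j_r`. -/
def idT : MT := fun i j r s =>
  (if i = r then (1 : ℝ) else 0) * (if j = s then 1 else 0) -
    (if i = s then 1 else 0) * (if j = r then 1 else 0)

/-- Composition `(κ∘η)^{ij}_{rs} = (1/2) κ^{ab}_{rs} η^{ij}_{ab}`. -/
def compT (κ η : MT) : MT := fun i j r s => (1 / 2) * ∑ a, ∑ b, κ a b r s * η i j a b

/-- Poincaré adjoint `κ̄^{ij}_{rs} = (1/4) ε_{rsab} κ^{ab}_{cd} ε^{cdij}`. -/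
def adjT (κ : MT) : MT := fun i j r s =>
  (1 / 4) * ∑ a, ∑ b, ∑ c, ∑ d, eps r s a b * κ a b c d * eps c d i j

/-- Trace `tr κ = (1/2) κ^{ij}_{ij}`. -/
def traceT (κ : MT) : ℝ := (1 / 2) * ∑ i, ∑ j, κ i j i j

def antisymBV (A : BV) : Prop := ∀ i j, A i j = - A j i

def antisymMT (κ : MT) : Prop :=
  (∀ i j r s, κ i j r s = - κ j i r s) ∧ (∀ i j r s, κ i j r s = - κ i j s r)

/-- The medium tensor `(ρ Ā⊗B)^{ij}_{rs} = ρ ε_{rsab} A^{ab} B^{ij}`. -/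
def tensAB (ρ : ℝ) (A B : BV) : MT := fun i j r s =>
  ρ * (∑ a, ∑ b, eps r s a b * A a b) * B i j

/-- Hodge star `(∗_g)^{ij}_{rs} = √|det g| g^{ia} g^{jb} ε_{abrs}`. -/
def hodge (g : Matrix (Fin 4) (Fin 4) ℝ) : MT := fun i j r s =>
  Real.sqrt |g.det| * ∑ a, ∑ b, g⁻¹ i a * g⁻¹ j b * eps a b r s

/-- The (non-symmetrised) Fresnel tensor density `𝒢₀^{ijkl}`. -/
def G0 (κ : MT) (i j k l : Fin 4) : ℝ :=
  (1 / 48) * ∑ a₁, ∑ a₂, ∑ a₃, ∑ a₄, ∑ b₁, ∑ b₂, ∑ b₃, ∑ b₄, ∑ b₅, ∑ b₆,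
    κ a₁ a₂ b₁ b₂ * κ a₃ i b₃ b₄ * κ a₄ j b₅ b₆ *
      eps b₁ b₂ b₅ k * eps b₃ b₄ b₆ l * eps a₁ a₂ a₃ a₄

/-- Fresnel polynomial `G(ξ) = 𝒢₀^{ijkl} ξ_i ξ_j ξ_k ξ_l`. -/
def fresnel (κ : MT) (ξ : Fin 4 → ℝ) : ℝ :=
  ∑ i, ∑ j, ∑ k, ∑ l, G0 κ i j k l * ξ i * ξ j * ξ k * ξ l

/-- A Lorentz metric: real symmetric invertible 4×4 matrix of signature
(−+++) or (+−−−), equivalently symmetric with negative determinant. -/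
def IsLorentz (g : Matrix (Fin 4) (Fin 4) ℝ) : Prop := g.IsSymm ∧ g.det < 0

/-- Null cone `N(g) = {ξ : g^{ij} ξ_i ξ_j = 0}` (on covectors, via the inverse metric). -/
def nullCone (g : Matrix (Fin 4) (Fin 4) ℝ) : Set (Fin 4 → ℝ) :=
  {ξ | ∑ i, ∑ j, g⁻¹ i j * ξ i * ξ j = 0}

/-- The ordering O = (01, 02, 03, 23, 31, 12) of index pairs. -/
def pairs : Fin 6 → Fin 4 × Fin 4 := ![(0, 1), (0, 2), (0, 3), (2, 3), (3, 1), (1, 2)]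

/-- The 6×6 matrix representing a medium tensor: `M_{IJ} = κ^{J₁J₂}_{I₁I₂}`. -/
def mat6 (κ : MT) : Matrix (Fin 6) (Fin 6) ℝ := fun I J =>
  κ (pairs J).1 (pairs J).2 (pairs I).1 (pairs I).2

/-- The Fresnel surface decomposes into a double light cone. -/
def DoubleCone (κ : MT) : Prop :=
  ∃ gp gm, IsLorentz gp ∧ IsLorentz gm ∧ nullCone gp ≠ nullCone gm ∧
    {ξ | fresnel κ ξ = 0} = nullCone gp ∪ nullCone gm

theorem sum_comm_two {ι : Type*} [Fintype ι] (f : ι → ι → ι → ℝ) :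
    ∑ i, ∑ j, ∑ x, f i j x = ∑ x, ∑ i, ∑ j, f i j x :=
  (Finset.sum_congr rfl fun _ _ => Finset.sum_comm).trans Finset.sum_comm

theorem sum_comm_three {ι : Type*} [Fintype ι] (f : ι → ι → ι → ι → ℝ) :
    ∑ i, ∑ j, ∑ k, ∑ x, f i j k x = ∑ x, ∑ i, ∑ j, ∑ k, f i j k x :=
  (Finset.sum_congr rfl fun _ _ => sum_comm_two _).trans Finset.sum_comm

theorem sum_comm_six {ι : Type*} [Fintype ι] (f : ι → ι → ι → ι → ι → ι → ι → ℝ) :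
    ∑ i, ∑ j, ∑ k, ∑ l, ∑ m, ∑ n, ∑ x, f i j k l m n x =
      ∑ x, ∑ i, ∑ j, ∑ k, ∑ l, ∑ m, ∑ n, f i j k l m n x := by
  refine Eq.trans (Finset.sum_congr rfl fun _ _ => Finset.sum_congr rfl fun _ _ =>
    Finset.sum_congr rfl fun _ _ => sum_comm_three _) ?_
  exact sum_comm_three _

theorem sum_comm_ten {ι : Type*} [Fintype ι]
    (f : ι → ι → ι → ι → ι → ι → ι → ι → ι → ι → ι → ℝ) :
    ∑ i, ∑ j, ∑ k, ∑ l, ∑ m, ∑ n, ∑ o, ∑ p, ∑ q, ∑ r, ∑ x, f i j k l m n o p q r x =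
      ∑ x, ∑ i, ∑ j, ∑ k, ∑ l, ∑ m, ∑ n, ∑ o, ∑ p, ∑ q, ∑ r,
        f i j k l m n o p q r x := by
  refine Eq.trans (Finset.sum_congr rfl fun _ _ => Finset.sum_congr rfl fun _ _ =>
    Finset.sum_congr rfl fun _ _ => (Finset.sum_congr rfl fun _ _ => sum_comm_six _).trans
      Finset.sum_comm) ?_
  exact sum_comm_three _

theorem sum_reorder {ι : Type*} [Fintype ι]
    (F : ι → ι → ι → ι → ι → ι → ι → ι → ι → ι → ι → ι → ι → ι → ℝ) :
    ∑ i, ∑ j, ∑ k, ∑ l, ∑ a₁, ∑ a₂, ∑ a₃, ∑ a₄, ∑ b₁, ∑ b₂, ∑ b₃, ∑ b₄, ∑ b₅, ∑ b₆,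
      F i j k l a₁ a₂ a₃ a₄ b₁ b₂ b₃ b₄ b₅ b₆ =
    ∑ a₃, ∑ a₄, ∑ b₅, ∑ b₆, ∑ k, ∑ a₁, ∑ a₂, ∑ b₁, ∑ b₂, ∑ j, ∑ b₃, ∑ b₄, ∑ i, ∑ l,
      F i j k l a₁ a₂ a₃ a₄ b₁ b₂ b₃ b₄ b₅ b₆ := by
  refine (sum_comm_six _).trans (Finset.sum_congr rfl fun _ _ => ?_)
  refine (sum_comm_six _).trans (Finset.sum_congr rfl fun _ _ => ?_)
  refine (sum_comm_ten _).trans (Finset.sum_congr rfl fun _ _ => ?_)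
  refine (sum_comm_ten _).trans (Finset.sum_congr rfl fun _ _ => ?_)
  refine (sum_comm_two _).trans (Finset.sum_congr rfl fun _ _ => ?_)
  iterate 4 refine (sum_comm_three _).trans (Finset.sum_congr rfl fun _ _ => ?_)
  refine Finset.sum_comm.trans (Finset.sum_congr rfl fun _ _ => ?_)
  iterate 2 refine (sum_comm_two _).trans (Finset.sum_congr rfl fun _ _ => ?_)
  rfl

theorem mul_sum_ten_mul {ι : Type*} [Fintype ι] (c x y z w : ℝ)
    (f : ι → ι → ι → ι → ι → ι → ι → ι → ι → ι → ℝ) :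
    (c * ∑ a₁, ∑ a₂, ∑ a₃, ∑ a₄, ∑ b₁, ∑ b₂, ∑ b₃, ∑ b₄, ∑ b₅, ∑ b₆,
      f a₁ a₂ a₃ a₄ b₁ b₂ b₃ b₄ b₅ b₆) * x * y * z * w =
    c * ∑ a₁, ∑ a₂, ∑ a₃, ∑ a₄, ∑ b₁, ∑ b₂, ∑ b₃, ∑ b₄, ∑ b₅, ∑ b₆,
      f a₁ a₂ a₃ a₄ b₁ b₂ b₃ b₄ b₅ b₆ * (x * y * z * w) := by
  simp only [mul_assoc, Finset.sum_mul]

theorem sum_mul_sum_mul_sum {ι : Type*} [Fintype ι] (p : ι → ι → ι → ι → ι → ℝ) (v : ι → ℝ)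
    (u w : ι → ι → ι → ℝ) :
    (∑ k, ∑ a₁, ∑ a₂, ∑ b₁, ∑ b₂, p k a₁ a₂ b₁ b₂) * (∑ j, v j) *
      (∑ e, ∑ f, (∑ i, u e f i) * ∑ l, w e f l) =
    ∑ k, ∑ a₁, ∑ a₂, ∑ b₁, ∑ b₂, ∑ j, ∑ e, ∑ f, ∑ i, ∑ l,
      p k a₁ a₂ b₁ b₂ * v j * (u e f i * w e f l) := by
  iterate 5
    rw [Finset.sum_mul, Finset.sum_mul]
    refine Finset.sum_congr rfl fun _ _ => ?_
  rw [Finset.mul_sum Finset.univ v, Finset.sum_mul]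
  refine Finset.sum_congr rfl fun _ _ => ?_
  iterate 2
    rw [Finset.mul_sum]
    refine Finset.sum_congr rfl fun _ _ => ?_
  rw [Finset.sum_mul_sum, Finset.mul_sum]
  refine Finset.sum_congr rfl fun _ _ => ?_
  rw [Finset.mul_sum]

theorem eps_swap_pairs (i j k l : Fin 4) : eps i j k l = eps k l i j := by
  simp only [eps]; ring

/-- The contraction `P^a_{bc} = κ^{ai}_{bc} ξ_i`. -/
def contrT (κ : MT) (ξ : Fin 4 → ℝ) (a b c : Fin 4) : ℝ := ∑ i, κ a i b c * ξ i

theorem contrT_eq_adj {κ : MT} (hskew : adjT κ = κ) (ξ : Fin 4 → ℝ) (a b c : Fin 4) :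
    ∑ k, ∑ a₁, ∑ a₂, ∑ b₁, ∑ b₂,
      eps a₁ a₂ b c * κ a₁ a₂ b₁ b₂ * eps b₁ b₂ a k * ξ k = 4 * contrT κ ξ a b c := by
  have h : ∀ k, κ a k b c = adjT κ a k b c := fun k => by rw [hskew]
  simp only [contrT, h, adjT, Finset.mul_sum, Finset.sum_mul]
  refine Finset.sum_congr rfl fun k _ => Finset.sum_congr rfl fun a₁ _ =>
    Finset.sum_congr rfl fun a₂ _ => ?_
  repeat refine Finset.sum_congr rfl fun _ _ => ?_
  rw [eps_swap_pairs a₁ a₂]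
  ring

theorem fresnel_eq_sum_contrT {κ : MT} (hskew : adjT κ = κ) (ξ : Fin 4 → ℝ) :
    fresnel κ ξ = (1 / 12) * ∑ a, ∑ d, ∑ b, ∑ c, contrT κ ξ b a d * contrT κ ξ d b c *
        ∑ e, ∑ f, contrT κ ξ a e f * ∑ g, eps e f c g * ξ g := by
  have h : fresnel κ ξ = (1 / 48) * ∑ a, ∑ d, ∑ b, ∑ c,
      (∑ k, ∑ a₁, ∑ a₂, ∑ b₁, ∑ b₂,
      eps a₁ a₂ a d * κ a₁ a₂ b₁ b₂ * eps b₁ b₂ b k * ξ k) * contrT κ ξ d b c *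
        ∑ e, ∑ f, contrT κ ξ a e f * ∑ g, eps e f c g * ξ g := by
    refine Eq.trans ?_ (congrArg (1 / 48 * ·) (sum_reorder fun i j k l a₁ a₂ a₃ a₄ b₁ b₂ b₃ b₄ b₅ b₆ =>
      κ a₁ a₂ b₁ b₂ * κ a₃ i b₃ b₄ * κ a₄ j b₅ b₆ * eps b₁ b₂ b₅ k * eps b₃ b₄ b₆ l *
        eps a₁ a₂ a₃ a₄ * (ξ i * ξ j * ξ k * ξ l)) |>.trans ?_)
    · unfold fresnel G0
      iterate 4
        rw [Finset.mul_sum]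
        refine Finset.sum_congr rfl fun _ _ => ?_
      exact mul_sum_ten_mul _ _ _ _ _ _
    refine congrArg (1 / 48 * ·) ?_
    iterate 4 refine Finset.sum_congr rfl fun _ _ => ?_
    refine Eq.trans ?_ (sum_mul_sum_mul_sum _ _ _ _).symm
    repeat refine Finset.sum_congr rfl fun _ _ => ?_
    ring
  simp only [h, contrT_eq_adj hskew, Finset.mul_sum]
  repeat refine Finset.sum_congr rfl fun _ _ => ?_
  ring

/-- The pairing of bivectors induced by the Levi-Civita symbol, in the ordering `pairs`. -/
def pairJ : Matrix (Fin 6) (Fin 6) ℝ := fun I K => if K = I + 3 then 1 else 0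

/-- The antisymmetric matrix with components `v` in the ordering `pairs`. -/
def asym (v : Fin 6 → ℝ) : Matrix (Fin 4) (Fin 4) ℝ :=
  !![0, v 0, v 1, v 2; -v 0, 0, v 5, -v 4; -v 1, -v 5, 0, v 3; -v 2, v 4, -v 3, 0]

/-- The second compound matrix: the action of `L` on bivectors in the ordering `pairs`. -/
def compound (L : Matrix (Fin 4) (Fin 4) ℝ) : Matrix (Fin 6) (Fin 6) ℝ := fun I K =>
  L (pairs I).1 (pairs K).1 * L (pairs I).2 (pairs K).2 -
    L (pairs I).1 (pairs K).2 * L (pairs I).2 (pairs K).1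

/-- The matrix of exterior multiplication `α ↦ α ∧ ξ` of covectors. -/
def wedgeMat (ξ : Fin 4 → ℝ) : Matrix (Fin 6) (Fin 4) ℝ := fun I a =>
  (if a = (pairs I).1 then ξ (pairs I).2 else 0) - (if a = (pairs I).2 then ξ (pairs I).1 else 0)

/-- The quadratic form `α ↦ Y(α ∧ ξ, α ∧ ξ)`. -/
def wedgeForm (Y : Matrix (Fin 6) (Fin 6) ℝ) (ξ : Fin 4 → ℝ) : Matrix (Fin 4) (Fin 4) ℝ :=
  (wedgeMat ξ)ᵀ * Y * wedgeMat ξ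

/-- The matrices `(a, b) ↦ P^a_{bc}` obtained by contracting a medium tensor with `ξ`. -/
def contrMat (Y : Matrix (Fin 6) (Fin 6) ℝ) (ξ : Fin 4 → ℝ) (c : Fin 4) :
    Matrix (Fin 4) (Fin 4) ℝ := fun a b => asym ((pairJ * Y * wedgeMat ξ).col a) b c

/-- The Fresnel polynomial in terms of the symmetric matrix `Y = pairJ * mat6 κ`. -/
def fresnelForm (Y : Matrix (Fin 6) (Fin 6) ℝ) (ξ : Fin 4 → ℝ) : ℝ :=
  -(1 / 6) * ∑ a, ∑ c, wedgeForm Y ξ a c * (contrMat Y ξ a * contrMat Y ξ c).trace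

theorem pairJ_mul_self : pairJ * pairJ = 1 := by
  ext I K
  fin_cases I <;> fin_cases K <;> simp [pairJ, Matrix.mul_apply, Fin.sum_univ_six]

theorem pairJ_transpose : pairJᵀ = pairJ := by
  ext I K
  fin_cases I <;> fin_cases K <;> simp [pairJ]

theorem pairJ_mulVec (v : Fin 6 → ℝ) : pairJ *ᵥ v = ![v 3, v 4, v 5, v 0, v 1, v 2] := by
  ext I
  fin_cases I <;> simp [pairJ, Matrix.mulVec, dotProduct]

theorem asym_smul (r : ℝ) (v : Fin 6 → ℝ) : asym (r • v) = r • asym v := by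
  ext i j
  fin_cases i <;> fin_cases j <;> simp [asym]

theorem asym_add (v w : Fin 6 → ℝ) : asym (v + w) = asym v + asym w := by
  ext i j
  fin_cases i <;> fin_cases j <;> simp [asym] <;> ring

theorem asym_apply_pairs {A : BV} (hA : antisymBV A) :
    asym (fun I => A (pairs I).1 (pairs I).2) = Matrix.of A := by
  have h₀ : ∀ i, A i i = 0 := fun i => by have := hA i i; linarith
  ext i j
  fin_cases i <;> fin_cases j <;> simp [asym, pairs, h₀] <;> exact (hA _ _).symm

theorem mat6_mul_wedgeMat {κ : MT} (hanti : antisymMT κ) (ξ : Fin 4 → ℝ) (I : Fin 6)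
    (a : Fin 4) :
    (mat6 κ * wedgeMat ξ) I a = contrT κ ξ a (pairs I).1 (pairs I).2 := by
  obtain ⟨h, -⟩ := hanti
  have h₀ : ∀ i r s, κ i i r s = 0 := fun i r s => by have := h i i r s; linarith
  generalize hr : (pairs I).1 = r
  generalize hs : (pairs I).2 = s
  simp only [Matrix.mul_apply, mat6, contrT, hr, hs, Fin.sum_univ_six, Fin.sum_univ_four]
  fin_cases a <;> simp [pairs, wedgeMat, h₀] <;>
    simp only [h 1 0, h 2 0, h 3 0, h 2 1, h 1 3, h 3 2] <;> ring

theorem contrMat_pairJ_mul_mat6 {κ : MT} (hanti : antisymMT κ) (ξ : Fin 4 → ℝ)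
    (a b c : Fin 4) : contrMat (pairJ * mat6 κ) ξ c a b = contrT κ ξ a b c := by
  have h : antisymBV (contrT κ ξ a) := fun i j => by
    simp only [contrT, ← Finset.sum_neg_distrib]
    exact Finset.sum_congr rfl fun k _ => by rw [hanti.2]; ring
  have e : (pairJ * (pairJ * mat6 κ) * wedgeMat ξ).col a =
      fun I => contrT κ ξ a (pairs I).1 (pairs I).2 := by
    ext I
    rw [← Matrix.mul_assoc pairJ, pairJ_mul_self, Matrix.one_mul, Matrix.col_apply,
      mat6_mul_wedgeMat hanti]
  rw [contrMat, e, asym_apply_pairs h, Matrix.of_apply]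

theorem sum_asym_mul_eps (v : Fin 6 → ℝ) (ξ : Fin 4 → ℝ) (c : Fin 4) :
    ∑ e, ∑ f, asym v e f * ∑ g, eps e f c g * ξ g = 2 * (v ᵥ* (pairJ * wedgeMat ξ)) c := by
  simp only [← Matrix.vecMul_vecMul]
  rw [← Matrix.mulVec_transpose pairJ, pairJ_transpose, pairJ_mulVec]
  simp only [Fin.sum_univ_four, Matrix.vecMul, dotProduct, Fin.sum_univ_six]
  fin_cases c <;> simp [asym, wedgeMat, pairs, eps] <;> ring

theorem fresnel_eq_fresnelForm {κ : MT} (hanti : antisymMT κ) (hskew : adjT κ = κ)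
    (hsymm : (pairJ * mat6 κ).IsSymm) (ξ : Fin 4 → ℝ) :
    fresnel κ ξ = fresnelForm (pairJ * mat6 κ) ξ := by
  have h₁ : ∀ a c, ∑ e, ∑ f, contrT κ ξ a e f * ∑ g, eps e f c g * ξ g =
      2 * wedgeForm (pairJ * mat6 κ) ξ a c := fun a c => by
    have e := sum_asym_mul_eps ((mat6 κ * wedgeMat ξ).col a) ξ c
    have h : ∀ i j, asym ((mat6 κ * wedgeMat ξ).col a) i j = contrT κ ξ a i j := fun i j => by
      rw [← contrMat_pairJ_mul_mat6 hanti, contrMat, ← Matrix.mul_assoc pairJ, pairJ_mul_self,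
        Matrix.one_mul]
    simp only [h] at e
    rw [e, wedgeForm, ← hsymm.eq, Matrix.transpose_mul, pairJ_transpose,
      ← Matrix.mul_assoc, ← Matrix.transpose_mul, Matrix.mul_assoc]
    rfl
  have h₂ : ∀ a b d, contrT κ ξ b a d = -contrT κ ξ b d a := fun a b d => by
    simp only [contrT, ← Finset.sum_neg_distrib]
    exact Finset.sum_congr rfl fun k _ => by rw [hanti.2]; ring
  rw [fresnel_eq_sum_contrT hskew, fresnelForm]
  simp only [h₁, Matrix.trace, Matrix.diag, Matrix.mul_apply, contrMat_pairJ_mul_mat6 hanti]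
  simp only [Finset.mul_sum]
  refine Finset.sum_congr rfl fun a _ => ?_
  rw [sum_comm_two]
  refine Finset.sum_congr rfl fun c _ => ?_
  rw [Finset.sum_comm]
  refine Finset.sum_congr rfl fun b _ => Finset.sum_congr rfl fun d _ => ?_
  rw [h₂]
  ring

theorem compound_mul_pairJ_mul_transpose (L : Matrix (Fin 4) (Fin 4) ℝ) :
    compound L * pairJ * (compound L)ᵀ = L.det • pairJ := by
  ext I K
  have h : (compound L * pairJ * (compound L)ᵀ) I K =
      ((compound L).row I) ⬝ᵥ pairJ *ᵥ ((compound L).row K) := by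
    rw [Matrix.mul_assoc, Matrix.mul_apply', dotProduct, dotProduct]
    rfl
  rw [h, pairJ_mulVec, Matrix.det_succ_row_zero]
  simp only [Matrix.det_fin_three, Fin.sum_univ_four, dotProduct, Fin.sum_univ_six, compound,
    Matrix.row]
  fin_cases I <;> fin_cases K <;> simp [pairJ, pairs, Fin.succAbove] <;> ring

theorem compound_transpose (L : Matrix (Fin 4) (Fin 4) ℝ) : compound Lᵀ = (compound L)ᵀ := by
  ext I K
  simp only [compound, Matrix.transpose_apply]
  ring

theorem transpose_compound_mul_pairJ_mul (L : Matrix (Fin 4) (Fin 4) ℝ) :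
    (compound L)ᵀ * pairJ * compound L = L.det • pairJ := by
  simpa [compound_transpose] using compound_mul_pairJ_mul_transpose Lᵀ

theorem transpose_compound_mul_wedgeMat (L : Matrix (Fin 4) (Fin 4) ℝ) (ξ : Fin 4 → ℝ) :
    (compound L)ᵀ * wedgeMat ξ = wedgeMat (Lᵀ *ᵥ ξ) * Lᵀ := by
  ext I a
  simp only [Matrix.mul_apply, Fin.sum_univ_six, Fin.sum_univ_four, compound, wedgeMat,
    Matrix.transpose_apply, Matrix.mulVec, dotProduct]
  generalize (pairs I).1 = r
  generalize (pairs I).2 = s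
  have e : ∀ t : ℝ, ∀ u : Fin 4 → ℝ, ∀ r : Fin 4,
      ∑ i, (if i = r then t else 0) * u i = t * u r := by simp
  have h := e (∑ i, L i s * ξ i) (fun i => L a i) r
  have h' := e (∑ i, L i r * ξ i) (fun i => L a i) s
  simp only [Fin.sum_univ_four] at h h'
  trans (L 0 s * ξ 0 + L 1 s * ξ 1 + L 2 s * ξ 2 + L 3 s * ξ 3) * L a r -
    (L 0 r * ξ 0 + L 1 r * ξ 1 + L 2 r * ξ 2 + L 3 r * ξ 3) * L a s
  · clear h h' e
    fin_cases a <;> simp [pairs] <;> ring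
  · rw [← h, ← h']
    ring

theorem asym_compound_mulVec (L : Matrix (Fin 4) (Fin 4) ℝ) (v : Fin 6 → ℝ) :
    asym (compound L *ᵥ v) = L * asym v * Lᵀ := by
  have h : ∀ i j, (L * asym v * Lᵀ) i j = ∑ k, ∑ l, L i k * asym v k l * L j l := fun i j => by
    simp only [Matrix.mul_apply, Finset.sum_mul, Matrix.transpose_apply]
    exact Finset.sum_comm
  ext i j
  rw [h]
  simp only [Fin.sum_univ_four]
  fin_cases i <;> fin_cases j <;>
    simp [asym, compound, pairs, Matrix.mulVec, dotProduct, Fin.sum_univ_six] <;> ring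

theorem transpose_mul_asym_mul (L : Matrix (Fin 4) (Fin 4) ℝ) (v : Fin 6 → ℝ) :
    Lᵀ * asym ((pairJ * compound L) *ᵥ v) * L = L.det • asym (pairJ *ᵥ v) := by
  rw [← asym_smul, ← Matrix.smul_mulVec, ← transpose_compound_mul_pairJ_mul,
    ← compound_transpose, Matrix.mul_assoc (compound Lᵀ),
    ← Matrix.mulVec_mulVec v (compound Lᵀ), asym_compound_mulVec, Matrix.transpose_transpose]

theorem sum_smul_contrMat_mul (L : Matrix (Fin 4) (Fin 4) ℝ) (Y : Matrix (Fin 6) (Fin 6) ℝ)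
    (ξ : Fin 4 → ℝ) (k : Fin 4) :
    (∑ c, L c k • contrMat (compound L * Y * (compound L)ᵀ) ξ c) * L =
      L.det • (L * contrMat Y (Lᵀ *ᵥ ξ) k) := by
  have h : ∀ a, (pairJ * (compound L * Y * (compound L)ᵀ) * wedgeMat ξ).col a =
      (pairJ * compound L) *ᵥ ∑ i, L a i • (Y * wedgeMat (Lᵀ *ᵥ ξ)).col i := fun a => by
    have e : pairJ * (compound L * Y * (compound L)ᵀ) * wedgeMat ξ =
        (pairJ * compound L) * (Y * wedgeMat (Lᵀ *ᵥ ξ) * Lᵀ) := by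
      simp only [Matrix.mul_assoc, transpose_compound_mul_wedgeMat]
    rw [e]
    ext I
    rw [Matrix.col_apply, Matrix.mul_apply, Matrix.mulVec, dotProduct]
    refine Finset.sum_congr rfl fun K _ => ?_
    rw [Matrix.mul_apply (M := Y * _), mul_comm]
    simp [mul_comm]
  have hs : ∀ a, pairJ *ᵥ ∑ i, L a i • (Y * wedgeMat (Lᵀ *ᵥ ξ)).col i =
      ∑ i, L a i • (pairJ * Y * wedgeMat (Lᵀ *ᵥ ξ)).col i := fun a => by
    rw [Matrix.mulVec_sum]
    refine Finset.sum_congr rfl fun i _ => ?_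
    rw [Matrix.mulVec_smul, Matrix.mul_assoc]
    rfl
  have hasym : ∀ (s : Fin 4 → ℝ) (v : Fin 4 → Fin 6 → ℝ),
      asym (∑ i, s i • v i) = ∑ i, s i • asym (v i) := fun s v => by
    simp only [Fin.sum_univ_four, asym_add, asym_smul]
  ext a b
  have e := congrFun (congrFun (transpose_mul_asym_mul L
    (∑ i, L a i • (Y * wedgeMat (Lᵀ *ᵥ ξ)).col i)) b) k
  rw [← h, hs, hasym] at e
  have e' : (L.det • (L * contrMat Y (Lᵀ *ᵥ ξ) k)) a b =
      (L.det • ∑ i, L a i • asym ((pairJ * Y * wedgeMat (Lᵀ *ᵥ ξ)).col i)) b k := by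
    simp [Matrix.mul_apply (M := L), contrMat, Matrix.sum_apply]
  rw [e', ← e, Matrix.mul_assoc]
  simp only [Matrix.mul_apply, Matrix.sum_apply, Matrix.smul_apply, contrMat,
    Matrix.transpose_apply, smul_eq_mul, Finset.sum_mul]
  rw [Finset.sum_comm]
  refine Finset.sum_congr rfl fun i _ => Finset.sum_congr rfl fun j _ => ?_
  ring

theorem fresnelForm_compound (L : Matrix (Fin 4) (Fin 4) ℝ) (hL : IsUnit L.det)
    (Y : Matrix (Fin 6) (Fin 6) ℝ) (ξ : Fin 4 → ℝ) :
    fresnelForm (compound L * Y * (compound L)ᵀ) ξ =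
      L.det ^ 2 * fresnelForm Y (Lᵀ *ᵥ ξ) := by
  have h₁ : wedgeForm (compound L * Y * (compound L)ᵀ) ξ =
      L * wedgeForm Y (Lᵀ *ᵥ ξ) * Lᵀ := by
    have e := transpose_compound_mul_wedgeMat L ξ
    have e' := congrArg Matrix.transpose e
    simp only [Matrix.transpose_mul, Matrix.transpose_transpose] at e'
    simp only [wedgeForm, Matrix.mul_assoc, e]
    simp only [← Matrix.mul_assoc, e']
  set M := contrMat (compound L * Y * (compound L)ᵀ) ξ with hM
  set M' := contrMat Y (Lᵀ *ᵥ ξ) with hM'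
  have h₂ : ∀ k, ∑ c, L c k • M c = L.det • (L * M' k * L⁻¹) := fun k => by
    rw [← Matrix.smul_mul, ← sum_smul_contrMat_mul, Matrix.mul_assoc,
      Matrix.mul_nonsing_inv _ hL, Matrix.mul_one]
  have h₃ : ∀ k l, ((∑ c, L c k • M c) * ∑ c, L c l • M c).trace =
      L.det ^ 2 * (M' k * M' l).trace := fun k l => by
    rw [h₂, h₂, Matrix.smul_mul, Matrix.mul_smul, smul_smul, Matrix.trace_smul,
      ← Matrix.mul_assoc, ← Matrix.mul_assoc, Matrix.mul_assoc _ L⁻¹ L,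
      Matrix.nonsing_inv_mul _ hL, Matrix.mul_one, Matrix.trace_mul_comm,
      ← Matrix.mul_assoc, ← Matrix.mul_assoc, Matrix.nonsing_inv_mul _ hL, Matrix.one_mul,
      smul_eq_mul, sq]
  have h₄ : ∑ a, ∑ c, wedgeForm (compound L * Y * (compound L)ᵀ) ξ a c * (M a * M c).trace =
      ∑ k, ∑ l, wedgeForm Y (Lᵀ *ᵥ ξ) k l *
        ((∑ c, L c k • M c) * ∑ c, L c l • M c).trace := by
    have h₅ : ∀ k l, ((∑ c, L c k • M c) * ∑ c, L c l • M c).trace =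
        ∑ a, ∑ c, L a k * (L c l * (M a * M c).trace) := fun k l => by
      rw [Matrix.sum_mul, Matrix.trace_sum]
      refine Finset.sum_congr rfl fun a _ => ?_
      rw [Matrix.mul_sum, Matrix.trace_sum]
      refine Finset.sum_congr rfl fun c _ => ?_
      rw [Matrix.smul_mul, Matrix.mul_smul, Matrix.trace_smul, Matrix.trace_smul, smul_eq_mul,
        smul_eq_mul]
    have h₆ : ∀ a c, (L * wedgeForm Y (Lᵀ *ᵥ ξ) * Lᵀ) a c =
        ∑ k, ∑ l, wedgeForm Y (Lᵀ *ᵥ ξ) k l * (L a k * L c l) := fun a c => by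
      rw [Finset.sum_comm]
      simp only [Matrix.mul_apply, Matrix.transpose_apply, Finset.sum_mul]
      refine Finset.sum_congr rfl fun k _ => Finset.sum_congr rfl fun l _ => ?_
      ring
    simp only [h₁, h₅, h₆]
    simp only [Finset.mul_sum, Finset.sum_mul]
    refine ((sum_comm_three _).trans (sum_comm_three _)).trans ?_
    refine Finset.sum_congr rfl fun k _ => Finset.sum_congr rfl fun l _ =>
      Finset.sum_congr rfl fun a _ => Finset.sum_congr rfl fun c _ => ?_
    ring
  rw [fresnelForm, fresnelForm, h₄, ← hM']
  simp only [h₃]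
  simp only [Finset.mul_sum]
  refine Finset.sum_congr rfl fun a _ => Finset.sum_congr rfl fun c _ => ?_
  ring

theorem sum_mul_of_antisymBV {f g : BV} (hf : antisymBV f) (hg : antisymBV g) :
    (1 / 2) * ∑ a, ∑ b, f a b * g a b =
      ∑ K, f (pairs K).1 (pairs K).2 * g (pairs K).1 (pairs K).2 := by
  have hf₀ : ∀ i, f i i = 0 := fun i => by have := hf i i; linarith
  simp only [Fin.sum_univ_four, Fin.sum_univ_six, pairs, hf₀]
  simp only [hf 1 0, hf 2 0, hf 3 0, hf 2 1, hf 1 3, hf 3 2, hg 1 0, hg 2 0, hg 3 0, hg 2 1,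
    hg 1 3, hg 3 2]
  simp
  ring

theorem sum_eps_mul_of_antisymBV {f : BV} (hf : antisymBV f) (I : Fin 6) :
    ∑ a, ∑ b, eps (pairs I).1 (pairs I).2 a b * f a b =
      2 * f (pairs (I + 3)).1 (pairs (I + 3)).2 := by
  have hf₀ : ∀ i, f i i = 0 := fun i => by have := hf i i; linarith
  simp only [Fin.sum_univ_four, hf₀]
  simp only [hf 1 0, hf 2 0, hf 3 0, hf 2 1, hf 1 3, hf 3 2]
  fin_cases I <;> simp [pairs, eps] <;> ring

theorem mat6_compT {κ η : MT} (hκ : antisymMT κ) (hη : antisymMT η) :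
    mat6 (compT κ η) = mat6 κ * mat6 η := by
  ext I K
  rw [Matrix.mul_apply]
  exact sum_mul_of_antisymBV (f := fun a b => κ a b _ _) (fun a b => hκ.1 a b _ _)
    (g := fun a b => η _ _ a b) fun a b => hη.2 _ _ a b

theorem mat6_adjT {κ : MT} (hκ : antisymMT κ) (I K : Fin 6) :
    mat6 (adjT κ) I K = mat6 κ (K + 3) (I + 3) := by
  have h : ∀ a b, ∑ c, ∑ d, κ a b c d * eps c d (pairs K).1 (pairs K).2 =
      2 * κ a b (pairs (K + 3)).1 (pairs (K + 3)).2 := fun a b => by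
    rw [← sum_eps_mul_of_antisymBV (f := fun c d => κ a b c d) (fun c d => hκ.2 a b c d)]
    refine Finset.sum_congr rfl fun c _ => Finset.sum_congr rfl fun d _ => ?_
    rw [eps_swap_pairs, mul_comm]
  simp only [mat6, adjT, mul_assoc, ← Finset.mul_sum, h]
  have h' := sum_eps_mul_of_antisymBV
    (f := fun a b => κ a b (pairs (K + 3)).1 (pairs (K + 3)).2) (fun a b => hκ.1 a b _ _) I
  simp only [mul_left_comm _ (2 : ℝ), ← Finset.mul_sum, h']
  ring

theorem pairJ_mul_apply (M : Matrix (Fin 6) (Fin 6) ℝ) (I K : Fin 6) :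
    (pairJ * M) I K = M (I + 3) K := by
  simp [pairJ, Matrix.mul_apply]

theorem isSymm_pairJ_mul_mat6 {κ : MT} (hκ : antisymMT κ) (hskew : adjT κ = κ) :
    (pairJ * mat6 κ).IsSymm := by
  ext I K
  have h : I + 3 + 3 = I := by revert I; decide
  have h' := mat6_adjT hκ (I + 3) K
  rw [hskew, h] at h'
  rw [Matrix.transpose_apply, pairJ_mul_apply, pairJ_mul_apply, h']

theorem antisymMT_idT : antisymMT idT := by
  constructor <;> intro i j r s <;> simp only [idT] <;> ring

theorem mat6_idT : mat6 idT = 1 := by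
  ext I K
  fin_cases I <;> fin_cases K <;> simp [mat6, idT, pairs]

theorem mat6_tensAB {A : BV} (hA : antisymBV A) (ρ : ℝ) (B : BV) :
    mat6 (tensAB ρ A B) = (2 * ρ) • (pairJ * vecMulVec (fun I => A (pairs I).1 (pairs I).2)
      fun I => B (pairs I).1 (pairs I).2) := by
  ext I K
  rw [Matrix.smul_apply, pairJ_mul_apply, vecMulVec_apply, smul_eq_mul]
  simp only [mat6, tensAB, sum_eps_mul_of_antisymBV hA]
  ring

theorem pairs_ne_zero {A : BV} (hA : antisymBV A) (hA0 : A ≠ 0) :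
    (fun I => A (pairs I).1 (pairs I).2) ≠ 0 := fun h => by
  have e := asym_apply_pairs hA
  rw [h] at e
  refine hA0 (funext fun i => funext fun j => ?_)
  have e' := congrFun (congrFun e i) j
  rw [Matrix.of_apply] at e'
  rw [← e']
  fin_cases i <;> fin_cases j <;> simp [asym]

theorem exists_symm_matrix {κ : MT} (hanti : antisymMT κ) (hskew : adjT κ = κ) {μ lam ρ : ℝ}
    {A B : BV} (hρ : ρ ≠ 0) (hA : antisymBV A) (hB : antisymBV B) (hA0 : A ≠ 0) (hB0 : B ≠ 0)
    (heq : compT (fun i j r s => κ i j r s + μ * idT i j r s)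
          (fun i j r s => κ i j r s + μ * idT i j r s) =
        fun i j r s =>
          -lam * idT i j r s + tensAB ρ A B i j r s + tensAB ρ B A i j r s) :
    ∃ (X : Matrix (Fin 6) (Fin 6) ℝ) (a b : Fin 6 → ℝ), X.IsSymm ∧ a ≠ 0 ∧ b ≠ 0 ∧
      X * pairJ * X = -lam • pairJ + (vecMulVec a b + vecMulVec b a) ∧
      ∀ ξ, fresnel κ ξ = fresnelForm (X - μ • pairJ) ξ := by
  have hs := isSymm_pairJ_mul_mat6 hanti hskew
  have hη : antisymMT (fun i j r s => κ i j r s + μ * idT i j r s) := by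
    constructor <;> intro i j r s
    · linear_combination hanti.1 i j r s + μ * antisymMT_idT.1 i j r s
    · linear_combination hanti.2 i j r s + μ * antisymMT_idT.2 i j r s
  have hη' : mat6 (fun i j r s => κ i j r s + μ * idT i j r s) = mat6 κ + μ • 1 := by
    rw [← mat6_idT]
    rfl
  have e := congrArg mat6 heq
  rw [mat6_compT hη hη, hη'] at e
  have e' : mat6 (fun i j r s =>
      -lam * idT i j r s + tensAB ρ A B i j r s + tensAB ρ B A i j r s) =
      -lam • 1 + mat6 (tensAB ρ A B) + mat6 (tensAB ρ B A) := by
    rw [← mat6_idT]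
    rfl
  rw [e', mat6_tensAB hA, mat6_tensAB hB] at e
  refine ⟨pairJ * (mat6 κ + μ • 1), (2 * ρ) • fun I => A (pairs I).1 (pairs I).2,
    fun I => B (pairs I).1 (pairs I).2, ?_, ?_, pairs_ne_zero hB hB0, ?_, fun ξ => ?_⟩
  · rw [Matrix.mul_add, Matrix.mul_smul, Matrix.mul_one]
    exact hs.add (by rw [Matrix.IsSymm, Matrix.transpose_smul, pairJ_transpose])
  · exact smul_ne_zero (mul_ne_zero two_ne_zero hρ) (pairs_ne_zero hA hA0)
  · have e₁ : ∀ M : Matrix (Fin 6) (Fin 6) ℝ,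
        pairJ * M * pairJ * (pairJ * M) = pairJ * (M * M) := fun M => by
      rw [Matrix.mul_assoc _ pairJ, ← Matrix.mul_assoc pairJ pairJ, pairJ_mul_self,
        Matrix.one_mul, Matrix.mul_assoc]
    rw [e₁, e, Matrix.smul_vecMulVec, Matrix.vecMulVec_smul]
    simp only [Matrix.mul_add, Matrix.mul_smul, ← Matrix.mul_assoc, pairJ_mul_self,
      Matrix.one_mul, Matrix.mul_one]
    exact add_assoc _ _ _
  · rw [Matrix.mul_add, Matrix.mul_smul, Matrix.mul_one, add_sub_cancel_right,
      fresnel_eq_fresnelForm hanti hskew hs]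

/-- The zero set of `F` contains no two-dimensional linear subspace. -/
def NoPlane (F : (Fin 4 → ℝ) → ℝ) : Prop :=
  ∀ V : Submodule ℝ (Fin 4 → ℝ), Module.finrank ℝ V = 2 →
    ¬((V : Set (Fin 4 → ℝ)) ⊆ {ξ | F ξ = 0})

/-- The zero set of `F` is the union of two distinct cones of Lorentzian quadratic forms. -/
def IsDoubleCone (F : (Fin 4 → ℝ) → ℝ) : Prop :=
  ∃ P M : Matrix (Fin 4) (Fin 4) ℝ, P.IsSymm ∧ M.IsSymm ∧ P.det < 0 ∧ M.det < 0 ∧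
    (∃ x, x ⬝ᵥ P *ᵥ x = 0 ∧ x ⬝ᵥ M *ᵥ x ≠ 0) ∧
    ∀ ξ, F ξ = 0 ↔ ξ ⬝ᵥ P *ᵥ ξ = 0 ∨ ξ ⬝ᵥ M *ᵥ ξ = 0

theorem IsDoubleCone.comp_mulVec {F : (Fin 4 → ℝ) → ℝ} (hF : IsDoubleCone F)
    {L : Matrix (Fin 4) (Fin 4) ℝ} (hL : IsUnit L.det) : IsDoubleCone fun ξ => F (Lᵀ *ᵥ ξ) := by
  obtain ⟨P, M, hP, hM, hPd, hMd, ⟨x, hx, hx'⟩, h⟩ := hF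
  have hsymm : ∀ Q : Matrix (Fin 4) (Fin 4) ℝ, Q.IsSymm → (L * Q * Lᵀ).IsSymm := fun Q hQ => by
    rw [Matrix.IsSymm, Matrix.transpose_mul, Matrix.transpose_mul, Matrix.transpose_transpose,
      hQ.eq, Matrix.mul_assoc]
  have hdet : ∀ Q : Matrix (Fin 4) (Fin 4) ℝ, Q.det < 0 → (L * Q * Lᵀ).det < 0 := fun Q hQ => by
    rw [Matrix.det_mul, Matrix.det_mul, Matrix.det_transpose, mul_right_comm]
    exact mul_neg_of_pos_of_neg (mul_self_pos.2 hL.ne_zero) hQ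
  have hform : ∀ Q : Matrix (Fin 4) (Fin 4) ℝ, ∀ ξ,
      ξ ⬝ᵥ (L * Q * Lᵀ) *ᵥ ξ = (Lᵀ *ᵥ ξ) ⬝ᵥ Q *ᵥ (Lᵀ *ᵥ ξ) := fun Q ξ => by
    rw [← Matrix.mulVec_mulVec, ← Matrix.mulVec_mulVec, Matrix.dotProduct_mulVec ξ,
      ← Matrix.mulVec_transpose]
  have hLt : IsUnit Lᵀ.det := by rwa [Matrix.det_transpose]
  refine ⟨L * P * Lᵀ, L * M * Lᵀ, hsymm P hP, hsymm M hM, hdet P hPd, hdet M hMd,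
    ⟨Lᵀ⁻¹ *ᵥ x, ?_⟩, fun ξ => ?_⟩
  · rw [hform, hform, Matrix.mulVec_mulVec, Matrix.mul_nonsing_inv _ hLt, Matrix.one_mulVec]
    exact ⟨hx, hx'⟩
  · rw [hform, hform]
    exact h _

theorem IsDoubleCone.exists_isLorentz {F : (Fin 4 → ℝ) → ℝ} (hF : IsDoubleCone F) :
    ∃ gp gm, IsLorentz gp ∧ IsLorentz gm ∧ nullCone gp ≠ nullCone gm ∧
      {ξ | F ξ = 0} = nullCone gp ∪ nullCone gm := by
  obtain ⟨P, M, hP, hM, hPd, hMd, ⟨x, hx, hx'⟩, h⟩ := hF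
  have hlor : ∀ Q : Matrix (Fin 4) (Fin 4) ℝ, Q.IsSymm → Q.det < 0 → IsLorentz Q⁻¹ :=
    fun Q hQ hd => by
      refine ⟨by rw [Matrix.IsSymm, Matrix.transpose_nonsing_inv, hQ.eq], ?_⟩
      rw [Matrix.det_nonsing_inv, Ring.inverse_eq_inv']
      exact inv_lt_zero.2 hd
  have hcone : ∀ Q : Matrix (Fin 4) (Fin 4) ℝ, Q.det < 0 →
      ∀ ξ, ξ ∈ nullCone Q⁻¹ ↔ ξ ⬝ᵥ Q *ᵥ ξ = 0 := fun Q hd ξ => by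
    rw [nullCone, Matrix.nonsing_inv_nonsing_inv _ hd.ne.isUnit, Set.mem_ofPred_eq]
    have e : ∑ i, ∑ j, Q i j * ξ i * ξ j = ξ ⬝ᵥ Q *ᵥ ξ := by
      simp only [dotProduct, Matrix.mulVec, Finset.mul_sum]
      refine Finset.sum_congr rfl fun i _ => Finset.sum_congr rfl fun j _ => ?_
      ring
    rw [e]
  refine ⟨P⁻¹, M⁻¹, hlor P hP hPd, hlor M hM hMd, fun e => ?_, ?_⟩
  · have hx₁ := (hcone P hPd x).2 hx
    rw [e] at hx₁
    exact hx' ((hcone M hMd x).1 hx₁)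
  · ext ξ
    rw [Set.mem_union, hcone P hPd, hcone M hMd]
    exact h ξ

theorem NoPlane.of_comp_mulVec {F : (Fin 4 → ℝ) → ℝ} {L : Matrix (Fin 4) (Fin 4) ℝ}
    (hL : IsUnit L.det) (hF : NoPlane fun ξ => F (Lᵀ *ᵥ ξ)) : NoPlane F := by
  intro V hV hVF
  have hLt : IsUnit Lᵀ.det := by rwa [Matrix.det_transpose]
  let e := Matrix.toLinearEquiv' Lᵀ (Matrix.invertibleOfIsUnitDet _ hLt)
  refine hF (V.map (e.symm : (Fin 4 → ℝ) →ₗ[ℝ] Fin 4 → ℝ)) ?_ ?_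
  · rw [← hV]
    exact LinearEquiv.finrank_map_eq _ _
  · rintro _ ⟨x, hx, rfl⟩
    have h : Lᵀ *ᵥ e.symm x = x := e.apply_symm_apply x
    change F (Lᵀ *ᵥ e.symm x) = 0
    rw [h]
    exact hVF hx

theorem NoPlane.exists_ne_zero {F : (Fin 4 → ℝ) → ℝ} (hF : NoPlane F) {u v : Fin 4 → ℝ}
    (huv : LinearIndependent ℝ ![u, v]) : ∃ x y : ℝ, F (x • u + y • v) ≠ 0 := by
  by_contra! h
  refine hF (Submodule.span ℝ (Set.range ![u, v])) ?_ fun ξ hξ => ?_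
  · rw [finrank_span_eq_card huv, Fintype.card_fin]
  · rw [Matrix.range_cons, Matrix.range_cons, Matrix.range_empty, Set.union_empty,
      Set.singleton_union, SetLike.mem_coe, Submodule.mem_span_pair] at hξ
    obtain ⟨x, y, rfl⟩ := hξ
    exact h x y

theorem exists_frame_matrix {L : Matrix (Fin 4) (Fin 4) ℝ} (hL : L.det ≠ 0) {lam : ℝ}
    {X : Matrix (Fin 6) (Fin 6) ℝ} (hX : X.IsSymm) {a b : Fin 6 → ℝ}
    (h : X * pairJ * X = -lam • pairJ + (vecMulVec (compound L *ᵥ a) (compound L *ᵥ b) +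
      vecMulVec (compound L *ᵥ b) (compound L *ᵥ a))) (ν : ℝ) :
    ∃ X' : Matrix (Fin 6) (Fin 6) ℝ, X'.IsSymm ∧
      X' * pairJ * X' = -(lam / L.det ^ 2) • pairJ +
        (vecMulVec (L.det⁻¹ • a) b + vecMulVec b (L.det⁻¹ • a)) ∧
      ∀ ξ, fresnelForm (X - ν • pairJ) ξ =
        L.det ^ 2 * fresnelForm (X' - (ν / L.det) • pairJ) (Lᵀ *ᵥ ξ) := by
  set d := L.det with hd
  set C := compound L with hC
  set D := d⁻¹ • (pairJ * Cᵀ * pairJ) with hD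
  have hDC : D * C = 1 := by
    rw [hD, Matrix.smul_mul, Matrix.mul_assoc, Matrix.mul_assoc, ← Matrix.mul_assoc Cᵀ,
      transpose_compound_mul_pairJ_mul, Matrix.mul_smul, pairJ_mul_self, smul_smul,
      inv_mul_cancel₀ hL, one_smul]
  have hCD : C * D = 1 := mul_eq_one_comm.1 hDC
  have hCD' : Dᵀ * Cᵀ = 1 := by rw [← Matrix.transpose_mul, hCD, Matrix.transpose_one]
  have hDJ : D * pairJ * Dᵀ = d⁻¹ • pairJ := by
    have e : pairJ = d⁻¹ • (C * pairJ * Cᵀ) := by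
      rw [compound_mul_pairJ_mul_transpose, smul_smul, inv_mul_cancel₀ hL, one_smul]
    have hDC' : Cᵀ * Dᵀ = 1 := by rw [← Matrix.transpose_mul, hDC, Matrix.transpose_one]
    conv_lhs => rw [e]
    rw [Matrix.mul_smul, Matrix.smul_mul, ← Matrix.mul_assoc, ← Matrix.mul_assoc, hDC,
      Matrix.one_mul, Matrix.mul_assoc, hDC', Matrix.mul_one]
  have hXC : C * (D * X * Dᵀ) * Cᵀ = X := by
    rw [← Matrix.mul_assoc, ← Matrix.mul_assoc, hCD, Matrix.one_mul, Matrix.mul_assoc, hCD',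
      Matrix.mul_one]
  have hJ : Dᵀ * pairJ * D = d⁻¹ • pairJ := by
    rw [hD, Matrix.transpose_smul, Matrix.transpose_mul, Matrix.transpose_mul, pairJ_transpose,
      Matrix.transpose_transpose]
    have e : pairJ * (C * pairJ) * pairJ * (pairJ * Cᵀ * pairJ) =
        pairJ * (C * pairJ * Cᵀ) * pairJ := by
      rw [Matrix.mul_assoc _ pairJ, Matrix.mul_assoc pairJ Cᵀ, ← Matrix.mul_assoc pairJ pairJ,
        pairJ_mul_self, Matrix.one_mul]
      simp only [Matrix.mul_assoc]
    rw [Matrix.smul_mul, Matrix.mul_smul, Matrix.smul_mul, e, compound_mul_pairJ_mul_transpose,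
      Matrix.mul_smul, Matrix.smul_mul, pairJ_mul_self, Matrix.one_mul, smul_smul, smul_smul,
      ← hd, mul_assoc, inv_mul_cancel₀ hL, mul_one]
  refine ⟨D * X * Dᵀ, ?_, ?_, fun ξ => ?_⟩
  · rw [Matrix.IsSymm, Matrix.transpose_mul, Matrix.transpose_mul, Matrix.transpose_transpose,
      hX.eq, Matrix.mul_assoc]
  · have e : D * X * Dᵀ * pairJ * (D * X * Dᵀ) = D * X * (Dᵀ * pairJ * D) * X * Dᵀ := by
      simp only [Matrix.mul_assoc]
    have e₂ : ∀ u v : Fin 6 → ℝ, D * vecMulVec (C *ᵥ u) (C *ᵥ v) * Dᵀ = vecMulVec u v :=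
      fun u v => by
        rw [Matrix.mul_vecMulVec, Matrix.vecMulVec_mul, Matrix.mulVec_mulVec, hDC,
          Matrix.one_mulVec, Matrix.vecMul_transpose, Matrix.mulVec_mulVec, hDC,
          Matrix.one_mulVec]
    rw [e, hJ, Matrix.mul_smul, Matrix.smul_mul, Matrix.smul_mul, Matrix.mul_assoc D X,
      Matrix.mul_assoc D, h, Matrix.mul_add, Matrix.mul_add, Matrix.add_mul, Matrix.add_mul,
      e₂, e₂, Matrix.mul_smul, Matrix.smul_mul, hDJ, smul_add, smul_add, smul_smul, smul_smul,
      Matrix.smul_vecMulVec, Matrix.vecMulVec_smul]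
    congr 2
    field_simp
  · rw [← fresnelForm_compound L hL.isUnit, Matrix.mul_sub, Matrix.sub_mul, hXC,
      Matrix.mul_smul, Matrix.smul_mul, compound_mul_pairJ_mul_transpose, smul_smul,
      div_mul_cancel₀ _ hL]

/-- The bivector `u ∧ v` in the ordering `pairs`. -/
def wedge (u v : Fin 4 → ℝ) : Fin 6 → ℝ := fun I =>
  u (pairs I).1 * v (pairs I).2 - u (pairs I).2 * v (pairs I).1

theorem pairJ_dotProduct (u v : Fin 6 → ℝ) :
    u ⬝ᵥ pairJ *ᵥ v = u 0 * v 3 + u 1 * v 4 + u 2 * v 5 + u 3 * v 0 + u 4 * v 1 + u 5 * v 2 := by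
  rw [pairJ_mulVec]
  simp [dotProduct, Fin.sum_univ_six]

theorem exists_eq_wedge {n : Fin 6 → ℝ} (hn : n ⬝ᵥ pairJ *ᵥ n = 0) :
    ∃ u v, n = wedge u v := by
  rw [pairJ_dotProduct] at hn
  by_cases h : n = 0
  · refine ⟨0, 0, ?_⟩
    rw [h]
    ext I
    simp [wedge]
  · obtain ⟨I, hI⟩ := Function.ne_iff.1 h
    rw [Pi.zero_apply] at hI
    refine ⟨(n I)⁻¹ • asym n (pairs I).1, asym n (pairs I).2, ?_⟩
    have e : n I • n = n I • wedge ((n I)⁻¹ • asym n (pairs I).1) (asym n (pairs I).2) := by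
      have e₂ : n I • wedge ((n I)⁻¹ • asym n (pairs I).1) (asym n (pairs I).2) =
          wedge (asym n (pairs I).1) (asym n (pairs I).2) := by
        ext K
        simp only [wedge, Pi.smul_apply, smul_eq_mul]
        field_simp
      rw [e₂]
      clear e₂ hI h
      ext K
      fin_cases I <;> fin_cases K <;> simp [wedge, pairs, asym] <;> linarith
    exact smul_right_injective _ hI e

theorem compound_mulVec_single (e : Fin 4 → Fin 4 → ℝ) (K : Fin 6) (x : ℝ) :
    compound (Matrix.of e)ᵀ *ᵥ Pi.single K x = x • wedge (e (pairs K).1) (e (pairs K).2) := by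
  ext I
  rw [Matrix.mulVec_single]
  simp [compound, wedge]
  ring

theorem det_eq_wedge (e : Fin 4 → Fin 4 → ℝ) :
    (Matrix.of e)ᵀ.det = wedge (e 0) (e 1) ⬝ᵥ pairJ *ᵥ wedge (e 2) (e 3) := by
  rw [Matrix.det_transpose, Matrix.det_succ_row_zero, pairJ_dotProduct]
  simp [Matrix.det_fin_three, Fin.sum_univ_four, wedge, pairs, Fin.succAbove]
  ring

theorem exists_null_pair {a b : Fin 6 → ℝ}
    (h : (a ⬝ᵥ pairJ *ᵥ a) * (b ⬝ᵥ pairJ *ᵥ b) < (a ⬝ᵥ pairJ *ᵥ b) ^ 2) :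
    ∃ m n : Fin 6 → ℝ, m ⬝ᵥ pairJ *ᵥ m = 0 ∧ n ⬝ᵥ pairJ *ᵥ n = 0 ∧ m ⬝ᵥ pairJ *ᵥ n ≠ 0 ∧
      ∃ x y z w : ℝ, a = x • m + y • n ∧ b = z • m + w • n ∧ x * w - y * z ≠ 0 := by
  set A := a ⬝ᵥ pairJ *ᵥ a with hA
  set B := a ⬝ᵥ pairJ *ᵥ b with hB
  set C := b ⬝ᵥ pairJ *ᵥ b with hC
  have hBa : b ⬝ᵥ pairJ *ᵥ a = B := by
    rw [hB, pairJ_dotProduct, pairJ_dotProduct]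
    ring
  have e : ∀ s t s' t' : ℝ, (s • a + t • b) ⬝ᵥ pairJ *ᵥ (s' • a + t' • b) =
      s * s' * A + (s * t' + t * s') * B + t * t' * C := fun s t s' t' => by
    simp only [Matrix.mulVec_add, Matrix.mulVec_smul, add_dotProduct, dotProduct_add,
      smul_dotProduct, dotProduct_smul, smul_eq_mul, hBa, ← hA, ← hB, ← hC]
    ring
  by_cases hA0 : A = 0
  · have hB0 : B ≠ 0 := by
      rintro h0
      rw [h0, hA0] at h
      simp at h
    refine ⟨(1 : ℝ) • a + (0 : ℝ) • b, (-(C / (2 * B))) • a + (1 : ℝ) • b, ?_, ?_, ?_,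
      1, 0, C / (2 * B), 1, ?_, ?_, by norm_num⟩
    · rw [e, hA0]; ring
    · rw [e, hA0]; field_simp; ring
    · rw [e, hA0]
      simpa using hB0
    · simp
    · ext i
      simp
  · obtain ⟨S, hS, hS0⟩ : ∃ S : ℝ, S * S = B ^ 2 - A * C ∧ S ≠ 0 :=
      ⟨√(B ^ 2 - A * C), Real.mul_self_sqrt (by linarith),
        (Real.sqrt_pos.2 (by linarith)).ne'⟩
    refine ⟨((-B + S) / A) • a + (1 : ℝ) • b, ((-B - S) / A) • a + (1 : ℝ) • b, ?_, ?_, ?_,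
      A / (2 * S), -(A / (2 * S)), 1 - (-B + S) / (2 * S), (-B + S) / (2 * S), ?_, ?_, ?_⟩
    · rw [e]; field_simp; linear_combination hS
    · rw [e]; field_simp; linear_combination hS
    · rw [e]
      have e' : (-B + S) / A * ((-B - S) / A) * A + ((-B + S) / A * 1 + 1 * ((-B - S) / A)) * B +
          1 * 1 * C = -2 * (S * S) / A := by
        rw [hS]; field_simp; linear_combination -hS
      rw [e']
      exact div_ne_zero (mul_ne_zero (by norm_num) (mul_ne_zero hS0 hS0)) hA0
    · ext i
      simp
      field_simp
      ring
    · ext i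
      simp
      field_simp
      ring
    · have e' : A / (2 * S) * ((-B + S) / (2 * S)) - -(A / (2 * S)) * (1 - (-B + S) / (2 * S)) =
          A / (2 * S) := by ring
      rw [e']
      exact div_ne_zero hA0 (mul_ne_zero two_ne_zero hS0)

theorem exists_frame_of_gram_neg {a b : Fin 6 → ℝ}
    (h : (a ⬝ᵥ pairJ *ᵥ a) * (b ⬝ᵥ pairJ *ᵥ b) < (a ⬝ᵥ pairJ *ᵥ b) ^ 2) :
    ∃ L : Matrix (Fin 4) (Fin 4) ℝ, L.det ≠ 0 ∧ ∃ x y z w : ℝ,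
      a = compound L *ᵥ ![x, 0, 0, y, 0, 0] ∧ b = compound L *ᵥ ![z, 0, 0, w, 0, 0] ∧
      x * w - y * z ≠ 0 := by
  obtain ⟨m, n, hm, hn, hmn, x, y, z, w, ha, hb, hd⟩ := exists_null_pair h
  obtain ⟨u, v, rfl⟩ := exists_eq_wedge hm
  obtain ⟨u', v', rfl⟩ := exists_eq_wedge hn
  have e : ∀ x y : ℝ, ![x, 0, 0, y, 0, 0] = Pi.single 0 x + Pi.single 3 y := fun x y => by
    ext i
    fin_cases i <;> simp
  have e' : ∀ x y : ℝ, compound (Matrix.of ![u, v, u', v'])ᵀ *ᵥ ![x, 0, 0, y, 0, 0] =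
      x • wedge u v + y • wedge u' v' := fun x y => by
    rw [e, Matrix.mulVec_add, compound_mulVec_single, compound_mulVec_single]
    rfl
  refine ⟨(Matrix.of ![u, v, u', v'])ᵀ, ?_, x, y, z, w, ?_, ?_, hd⟩
  · rw [det_eq_wedge]
    exact hmn
  · rw [e', ha]
  · rw [e', hb]

theorem wedge_add_smul_left (c₀ c₁ : ℝ) (u v w : Fin 4 → ℝ) :
    wedge (c₀ • u + c₁ • v) w = c₀ • wedge u w + c₁ • wedge v w := by
  ext I
  simp [wedge]
  ring

theorem wedge_self (u : Fin 4 → ℝ) : wedge u u = 0 := by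
  ext I
  simp [wedge]
  ring

theorem wedge_swap (u v : Fin 4 → ℝ) : wedge u v = -wedge v u := by
  ext I
  simp [wedge]
  ring

theorem wedge_smul_right (c : ℝ) (u v : Fin 4 → ℝ) : wedge u (c • v) = c • wedge u v := by
  ext I
  simp [wedge]
  ring

theorem wedge_add_smul_left_ne_zero {u v : Fin 4 → ℝ} (h : wedge u v ≠ 0) {c₀ c₁ : ℝ}
    (hc : c₀ ≠ 0 ∨ c₁ ≠ 0) : c₀ • u + c₁ • v ≠ 0 := fun h0 => by
  have e₁ : wedge (c₀ • u + c₁ • v) v = c₀ • wedge u v := by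
    rw [wedge_add_smul_left, wedge_self, smul_zero, add_zero]
  have e₂ : wedge (c₀ • u + c₁ • v) u = -(c₁ • wedge u v) := by
    rw [wedge_add_smul_left, wedge_self, smul_zero, zero_add, wedge_swap, smul_neg]
  have hz : ∀ w, wedge 0 w = 0 := fun w => by ext I; simp [wedge]
  rw [h0, hz] at e₁ e₂
  rcases hc with hc | hc
  · exact smul_ne_zero hc h e₁.symm
  · exact smul_ne_zero hc h (neg_eq_zero.1 e₂.symm)

theorem exists_wedge_eq {u v : Fin 4 → ℝ} {c₀ c₁ : ℝ} (hc : c₀ ≠ 0 ∨ c₁ ≠ 0) :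
    ∃ w, wedge u v = wedge (c₀ • u + c₁ • v) w := by
  rcases hc with hc | hc
  · refine ⟨c₀⁻¹ • v, ?_⟩
    rw [wedge_smul_right, wedge_add_smul_left, wedge_self, smul_zero, add_zero, smul_smul,
      inv_mul_cancel₀ hc, one_smul]
  · refine ⟨(-c₁⁻¹) • u, ?_⟩
    rw [wedge_smul_right, wedge_add_smul_left, wedge_self, smul_zero, zero_add, smul_smul,
      neg_mul, inv_mul_cancel₀ hc, wedge_swap v u, neg_one_smul, neg_neg]

theorem exists_common_factor {u v u' v' : Fin 4 → ℝ} (h : wedge u v ≠ 0)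
    (h' : wedge u' v' ≠ 0) (hd : wedge u v ⬝ᵥ pairJ *ᵥ wedge u' v' = 0) :
    ∃ e₀ e₁ e₂, wedge u v = wedge e₀ e₁ ∧ wedge u' v' = wedge e₀ e₂ := by
  obtain ⟨c, hc0, hc⟩ := Matrix.exists_mulVec_eq_zero_iff.2
    ((det_eq_wedge ![u, v, u', v']).trans hd)
  have hc' : c 0 • u + c 1 • v = (-c 2) • u' + (-c 3) • v' := by
    ext i
    have e := congrFun hc i
    simp [Matrix.mulVec, dotProduct, Fin.sum_univ_four] at e
    simp
    linarith
  have h01 : c 0 ≠ 0 ∨ c 1 ≠ 0 := by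
    by_contra! h0
    have h2 : -c 2 = 0 ∧ -c 3 = 0 := by
      by_contra h2
      refine wedge_add_smul_left_ne_zero h' (not_and_or.1 h2) ?_
      rw [← hc', h0.1, h0.2]
      simp
    refine hc0 (funext fun i => ?_)
    fin_cases i
    exacts [h0.1, h0.2, neg_eq_zero.1 h2.1, neg_eq_zero.1 h2.2]
  have h23 : -c 2 ≠ 0 ∨ -c 3 ≠ 0 := by
    by_contra! h0
    refine wedge_add_smul_left_ne_zero h h01 ?_
    rw [hc', h0.1, h0.2]
    simp
  obtain ⟨e₁, he₁⟩ := exists_wedge_eq (u := u) (v := v) h01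
  obtain ⟨e₂, he₂⟩ := exists_wedge_eq (u := u') (v := v') h23
  exact ⟨_, e₁, e₂, he₁, by rw [hc', he₂]⟩

theorem exists_frame_of_gram_eq_zero {a b : Fin 6 → ℝ} (hab : LinearIndependent ℝ ![a, b])
    (haa : a ⬝ᵥ pairJ *ᵥ a = 0) (hbb : b ⬝ᵥ pairJ *ᵥ b = 0) (h : a ⬝ᵥ pairJ *ᵥ b = 0) :
    ∃ L : Matrix (Fin 4) (Fin 4) ℝ, L.det ≠ 0 ∧
      a = compound L *ᵥ Pi.single 0 1 ∧ b = compound L *ᵥ Pi.single 1 1 := by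
  obtain ⟨u, v, rfl⟩ := exists_eq_wedge haa
  obtain ⟨u', v', rfl⟩ := exists_eq_wedge hbb
  obtain ⟨e₀, e₁, e₂, he₁, he₂⟩ :=
    exists_common_factor (hab.ne_zero 0) (hab.ne_zero 1) h
  rw [he₁, he₂] at hab ⊢
  have hind : LinearIndependent ℝ ![e₀, e₁, e₂] := by
    rw [LinearIndependent.pair_iff] at hab
    rw [Fintype.linearIndependent_iff]
    intro g hg
    simp only [Fin.sum_univ_three, Matrix.cons_val_zero, Matrix.cons_val_one,
      Matrix.cons_val_two, Matrix.head_cons, Matrix.tail_cons] at hg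
    have e := hab (g 1) (g 2) (by
      have e : wedge e₀ (g 0 • e₀ + g 1 • e₁ + g 2 • e₂) =
          g 0 • wedge e₀ e₀ + (g 1 • wedge e₀ e₁ + g 2 • wedge e₀ e₂) := by
        ext I
        simp [wedge]
        ring
      rw [hg, wedge_self, smul_zero, zero_add] at e
      rw [← e]
      ext I
      simp [wedge])
    have h0 : e₀ ≠ 0 := by
      rintro rfl
      have := hab 1 0 (by ext I; simp [wedge])
      exact one_ne_zero this.1
    rw [e.1, e.2, zero_smul, zero_smul, add_zero, add_zero] at hg
    have h0' := (smul_eq_zero.1 hg).resolve_right h0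
    intro i
    fin_cases i
    exacts [h0', e.1, e.2]
  obtain ⟨e₃, he₃⟩ : ∃ x, x ∉ Submodule.span ℝ (Set.range ![e₀, e₁, e₂]) := by
    by_contra! hx
    have := finrank_span_eq_card hind
    rw [Submodule.eq_top_iff'.2 hx, finrank_top] at this
    simp at this
  have hrow : LinearIndependent ℝ (Matrix.of ![e₀, e₁, e₂, e₃]).row := by
    have e : (Matrix.of ![e₀, e₁, e₂, e₃]).row = Fin.snoc ![e₀, e₁, e₂] e₃ := by
      ext i j
      fin_cases i <;> rfl
    rw [e]
    exact linearIndependent_finSnoc.2 ⟨hind, he₃⟩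
  refine ⟨(Matrix.of ![e₀, e₁, e₂, e₃])ᵀ, ?_, ?_, ?_⟩
  · rw [Matrix.det_transpose]
    exact ((Matrix.isUnit_iff_isUnit_det _).1
      (Matrix.linearIndependent_rows_iff_isUnit.1 hrow)).ne_zero
  · rw [compound_mulVec_single, one_smul]
    rfl
  · rw [compound_mulVec_single, one_smul]
    rfl

section Gram

variable {X : Matrix (Fin 6) (Fin 6) ℝ} {a b : Fin 6 → ℝ} {lam : ℝ}

theorem mul_pairJ_mulVec_comm (hX : X.IsSymm)
    (h : X * pairJ * X = -lam • pairJ + (vecMulVec a b + vecMulVec b a)) (i j : Fin 6) :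
    (X *ᵥ pairJ *ᵥ a) i * b j + (X *ᵥ pairJ *ᵥ b) i * a j =
      a i * (X *ᵥ pairJ *ᵥ b) j + b i * (X *ᵥ pairJ *ᵥ a) j := by
  have e : X * pairJ * (X * pairJ * X) = X * pairJ * X * pairJ * X := by
    simp only [Matrix.mul_assoc]
  have e' : ∀ v, v ᵥ* pairJ ᵥ* X = X *ᵥ pairJ *ᵥ v := fun v => by
    rw [← Matrix.mulVec_transpose, ← Matrix.mulVec_transpose, hX.eq, pairJ_transpose]
  rw [h, Matrix.mul_add, Matrix.mul_add, Matrix.add_mul, Matrix.add_mul, Matrix.add_mul,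
    Matrix.add_mul, Matrix.mul_smul, Matrix.smul_mul, Matrix.smul_mul, Matrix.mul_assoc X,
    pairJ_mul_self, Matrix.one_mul, Matrix.mul_one, Matrix.mul_vecMulVec,
    Matrix.mul_vecMulVec, Matrix.vecMulVec_mul, Matrix.vecMulVec_mul, Matrix.vecMulVec_mul,
    Matrix.vecMulVec_mul, ← Matrix.mulVec_mulVec, ← Matrix.mulVec_mulVec, e', e'] at e
  have e₂ := congrFun (congrFun e i) j
  simpa [Matrix.add_apply, vecMulVec_apply] using e₂

theorem mulVec_pairJ_mulVec_mulVec
    (h : X * pairJ * X = -lam • pairJ + (vecMulVec a b + vecMulVec b a)) (v : Fin 6 → ℝ) :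
    X *ᵥ pairJ *ᵥ X *ᵥ pairJ *ᵥ v =
      -lam • v + ((b ⬝ᵥ pairJ *ᵥ v) • a + (a ⬝ᵥ pairJ *ᵥ v) • b) := by
  rw [Matrix.mulVec_mulVec, Matrix.mulVec_mulVec, Matrix.mulVec_mulVec, h, Matrix.add_mul,
    Matrix.smul_mul, pairJ_mul_self, Matrix.add_mulVec, Matrix.smul_mulVec, Matrix.one_mulVec,
    ← Matrix.mulVec_mulVec, Matrix.add_mulVec, Matrix.vecMulVec_mulVec,
    Matrix.vecMulVec_mulVec]
  simp

theorem linearIndependent_of_quadratic (hX : X.IsSymm) (hlam : 0 < lam) (ha : a ≠ 0)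
    (hb : b ≠ 0) (h : X * pairJ * X = -lam • pairJ + (vecMulVec a b + vecMulVec b a)) :
    LinearIndependent ℝ ![a, b] := by
  by_contra hab
  rw [LinearIndependent.pair_iff' ha] at hab
  push Not at hab
  obtain ⟨t, rfl⟩ := hab
  have ht : t ≠ 0 := by
    rintro rfl
    exact hb (zero_smul _ _)
  obtain ⟨k, hk⟩ := Function.ne_iff.1 ha
  rw [Pi.zero_apply] at hk
  obtain ⟨z, hz⟩ : ∃ z : ℝ, X *ᵥ pairJ *ᵥ a = z • a := by
    refine ⟨(X *ᵥ pairJ *ᵥ a) k / a k, funext fun i => ?_⟩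
    have e := mul_pairJ_mulVec_comm hX h i k
    simp only [Matrix.mulVec_smul, Pi.smul_apply, smul_eq_mul] at e
    have e₂ : t * ((X *ᵥ pairJ *ᵥ a) i * a k) = t * (a i * (X *ᵥ pairJ *ᵥ a) k) := by linarith
    have e₃ := mul_left_cancel₀ ht e₂
    rw [Pi.smul_apply, smul_eq_mul]
    field_simp
    linarith
  set m := a ⬝ᵥ pairJ *ᵥ a with hm
  have hzm : z ^ 2 + lam = 2 * t * m := by
    have e := congrFun (mulVec_pairJ_mulVec_mulVec h a) k
    rw [hz, Matrix.mulVec_smul, Matrix.mulVec_smul, hz] at e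
    simp only [Pi.add_apply, Pi.smul_apply, smul_eq_mul, smul_dotProduct, ← hm] at e
    refine mul_right_cancel₀ hk ?_
    linear_combination e
  have hm0 : m ≠ 0 := by
    intro h0
    rw [h0, mul_zero] at hzm
    nlinarith [sq_nonneg z]
  obtain ⟨x, hxm⟩ : ∃ x, x * m = 1 - z := ⟨(1 - z) / m, div_mul_cancel₀ _ hm0⟩
  set K := X * pairJ with hK
  set w := pairJ *ᵥ a with hw
  have hKK : K * K = -lam • 1 + (2 * t) • vecMulVec a w := by
    rw [hK, ← Matrix.mul_assoc, h, Matrix.add_mul, Matrix.smul_mul, pairJ_mul_self,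
      Matrix.smul_vecMulVec, Matrix.vecMulVec_smul, Matrix.add_mul, Matrix.smul_mul,
      Matrix.vecMulVec_mul, ← Matrix.mulVec_transpose, pairJ_transpose, ← hw, ← add_smul]
    congr 2
    ring
  have hKa : K *ᵥ a = z • a := by rw [hK, ← Matrix.mulVec_mulVec, hz]
  have hwK : w ᵥ* K = z • w := by
    have e : Kᵀ *ᵥ w = z • w := by
      rw [hK, Matrix.transpose_mul, pairJ_transpose, hX.eq, ← Matrix.mulVec_mulVec, hw, hz,
        Matrix.mulVec_smul]
    rw [← e, Matrix.mulVec_transpose]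
  have hwa : w ⬝ᵥ a = m := by rw [hm, dotProduct_comm]
  have hsq : (K + x • vecMulVec a w) * (K + x • vecMulVec a w) =
      -lam • 1 + ((lam + 1) / m) • vecMulVec a w := by
    rw [Matrix.add_mul, Matrix.mul_add, Matrix.mul_add, hKK, Matrix.mul_smul, Matrix.smul_mul,
      Matrix.smul_mul, Matrix.mul_smul, Matrix.mul_vecMulVec, Matrix.vecMulVec_mul, hKa, hwK,
      Matrix.vecMulVec_mul_vecMulVec, hwa]
    simp only [Matrix.smul_vecMulVec, Matrix.vecMulVec_smul]
    have e : (lam + 1) / m = 2 * t + x * z + x * z + x * (x * m) := by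
      rw [div_eq_iff hm0]
      linear_combination hzm - (2 * z + x * m + 1 - z) * hxm
    rw [e]
    module
  have hdet := congrArg Matrix.det hsq
  have e : -lam • 1 + ((lam + 1) / m) • vecMulVec a w =
      (-lam) • (1 + vecMulVec ((-(lam + 1) / (lam * m)) • a) w) := by
    rw [smul_add, Matrix.smul_vecMulVec, smul_smul]
    congr 2
    field_simp
  rw [Matrix.det_mul, e, Matrix.det_smul, Fintype.card_fin, Matrix.vecMulVec_eq Unit (_ • a),
    Matrix.det_one_add_replicateCol_mul_replicateRow, dotProduct_smul, hwa, smul_eq_mul] at hdet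
  have e₂ : (-lam) ^ 6 * (1 + -(lam + 1) / (lam * m) * m) = -lam ^ 5 := by
    field_simp
    ring
  rw [e₂] at hdet
  have := mul_self_nonneg (K + x • vecMulVec a w).det
  have := pow_pos hlam 5
  linarith

theorem gram_neg_or_eq_zero (hX : X.IsSymm) (hlam : 0 < lam)
    (hab : LinearIndependent ℝ ![a, b])
    (h : X * pairJ * X = -lam • pairJ + (vecMulVec a b + vecMulVec b a)) :
    (a ⬝ᵥ pairJ *ᵥ a) * (b ⬝ᵥ pairJ *ᵥ b) < (a ⬝ᵥ pairJ *ᵥ b) ^ 2 ∨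
      a ⬝ᵥ pairJ *ᵥ a = 0 ∧ b ⬝ᵥ pairJ *ᵥ b = 0 ∧ a ⬝ᵥ pairJ *ᵥ b = 0 := by
  obtain ⟨i, j, hij⟩ : ∃ i j, a i * b j - a j * b i ≠ 0 := by
    by_contra! h0
    obtain ⟨k, hk⟩ := Function.ne_iff.1 (hab.ne_zero 0)
    have e := (LinearIndependent.pair_iff.1 hab) (-b k) (a k) (by
      ext i
      simp
      linarith [h0 k i])
    exact hk e.2
  set c := X *ᵥ pairJ *ᵥ a with hc
  set d := X *ᵥ pairJ *ᵥ b with hd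
  have hcomm := mul_pairJ_mulVec_comm hX h
  rw [← hc, ← hd] at hcomm
  obtain ⟨p, q, s, hcp, hds⟩ :
      ∃ p q s : ℝ, c = p • a + q • b ∧ d = s • a + p • b := by
    refine ⟨(a i * d j - d i * a j) / (a i * b j - a j * b i),
      (a i * c j - c i * a j) / (a i * b j - a j * b i),
      (d i * b j - d j * b i) / (a i * b j - a j * b i), ?_, ?_⟩ <;>
    · ext k
      have e₁ := hcomm k i
      have e₂ := hcomm k j
      have e₃ := hcomm i j
      simp only [Pi.add_apply, Pi.smul_apply, smul_eq_mul]
      rw [div_mul_eq_mul_div, div_mul_eq_mul_div, ← add_div, eq_div_iff hij]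
      first
      | linear_combination a i * e₂ - a j * e₁
      | linear_combination b j * e₁ - b i * e₂ + b k * e₃
  have hind := LinearIndependent.pair_iff.1 hab
  have hba : b ⬝ᵥ pairJ *ᵥ a = a ⬝ᵥ pairJ *ᵥ b := by
    rw [pairJ_dotProduct, pairJ_dotProduct]
    ring
  have ea := mulVec_pairJ_mulVec_mulVec h a
  have eb := mulVec_pairJ_mulVec_mulVec h b
  rw [← hc, hcp, Matrix.mulVec_add, Matrix.mulVec_add, Matrix.mulVec_smul, Matrix.mulVec_smul,
    Matrix.mulVec_smul, Matrix.mulVec_smul, ← hc, ← hd, hcp, hds, hba] at ea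
  rw [← hd, hds, Matrix.mulVec_add, Matrix.mulVec_add, Matrix.mulVec_smul, Matrix.mulVec_smul,
    Matrix.mulVec_smul, Matrix.mulVec_smul, ← hc, ← hd, hcp, hds] at eb
  obtain ⟨e₁, e₂⟩ := hind (p * p + q * s + lam - a ⬝ᵥ pairJ *ᵥ b)
    (2 * p * q - a ⬝ᵥ pairJ *ᵥ a) (by
      linear_combination (norm := module) ea)
  obtain ⟨e₃, e₄⟩ := hind (2 * p * s - b ⬝ᵥ pairJ *ᵥ b)
    (p * p + q * s + lam - a ⬝ᵥ pairJ *ᵥ b) (by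
      linear_combination (norm := module) eb)
  set A := a ⬝ᵥ pairJ *ᵥ a
  set B := a ⬝ᵥ pairJ *ᵥ b
  set C := b ⬝ᵥ pairJ *ᵥ b
  have eA : A = 2 * p * q := by linarith
  have eB : B = p * p + q * s + lam := by linarith
  have eC : C = 2 * p * s := by linarith
  rw [eA, eB, eC]
  by_cases hp : p = 0
  · subst hp
    by_cases hqs : q * s + lam = 0
    · right
      refine ⟨by ring, by ring, by linarith⟩
    · left
      have : 0 < (q * s + lam) ^ 2 := by positivity
      linarith
  · left
    have hp2 : 0 < p * p := mul_self_pos.2 hp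
    rcases le_or_gt 0 (q * s) with hqs | hqs
    · nlinarith [sq_nonneg (p * p - q * s), mul_pos hlam hp2, mul_nonneg hlam.le hqs,
        mul_pos hlam hlam]
    · nlinarith [sq_nonneg (p * p + q * s + lam), mul_pos hp2 (neg_pos.2 hqs)]

end Gram

theorem wedgeMat_eq (ξ : Fin 4 → ℝ) : wedgeMat ξ = !![ξ 1, -ξ 0, 0, 0; ξ 2, 0, -ξ 0, 0;
    ξ 3, 0, 0, -ξ 0; 0, 0, ξ 3, -ξ 2; 0, -ξ 3, 0, ξ 1; 0, ξ 2, -ξ 1, 0] := by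
  ext I a
  fin_cases I <;> fin_cases a <;> simp [wedgeMat, pairs]

theorem mul_wedgeMat_eq (Y : Matrix (Fin 6) (Fin 6) ℝ) (ξ : Fin 4 → ℝ) (I : Fin 6) :
    (Y * wedgeMat ξ) I = ![Y I 0 * ξ 1 + Y I 1 * ξ 2 + Y I 2 * ξ 3,
      -Y I 0 * ξ 0 - Y I 4 * ξ 3 + Y I 5 * ξ 2, -Y I 1 * ξ 0 + Y I 3 * ξ 3 - Y I 5 * ξ 1,
      -Y I 2 * ξ 0 - Y I 3 * ξ 2 + Y I 4 * ξ 1] := by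
  ext a
  rw [Matrix.mul_apply, Fin.sum_univ_six, wedgeMat_eq]
  fin_cases a <;> simp <;> ring

theorem fresnelForm_eq_of_mul_wedgeMat {Y : Matrix (Fin 6) (Fin 6) ℝ} {ξ : Fin 4 → ℝ}
    {V : Matrix (Fin 6) (Fin 4) ℝ} (hV : Y * wedgeMat ξ = V) : fresnelForm Y ξ =
      -(1 / 6) * ∑ a, ∑ c, ((wedgeMat ξ)ᵀ * V) a c *
        ∑ b, ∑ e, asym (pairJ *ᵥ V.col b) e a * asym (pairJ *ᵥ V.col e) b c := by
  have h : ∀ a b c, contrMat Y ξ c a b = asym (pairJ *ᵥ V.col a) b c := fun a b c => by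
    rw [contrMat, Matrix.mul_assoc, hV]
    rfl
  simp only [fresnelForm, wedgeForm, Matrix.mul_assoc, hV, Matrix.trace, Matrix.diag_apply,
    Matrix.mul_apply (M := contrMat _ _ _), h]

/-- Solutions of the quadratic equation with degenerate right-hand side, in an adapted frame. -/
def nullMat (s k t z w x y : ℝ) : Matrix (Fin 6) (Fin 6) ℝ :=
  !![x + w ^ 2 * t + z ^ 2 * s * k, -w * z * t * k, w * t, 0, s, z * s * k;
    -w * z * t * k, y, -z * t * k, t * k, 0, -w * t * k;
    w * t, -z * t * k, t, 0, 0, 0;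
    0, t * k, 0, 0, 0, 0;
    s, 0, 0, 0, 0, 0;
    z * s * k, -w * t * k, 0, 0, 0, s * k]

theorem nullMat_eq_compound (s k t z w x y : ℝ) :
    nullMat s k t z w x y = compound !![1, 0, -z, 0; 0, 1, 0, w; 0, 0, 1, 0; 0, 0, 0, 1] *
      nullMat s k t 0 0 x y *
      (compound !![1, 0, -z, 0; 0, 1, 0, w; 0, 0, 1, 0; 0, 0, 0, 1])ᵀ := by
  have h : compound !![1, 0, -z, 0; 0, 1, 0, w; 0, 0, 1, 0; 0, 0, 0, 1] =
      !![1, 0, w, -(z * w), 0, z; 0, 1, 0, 0, 0, 0; 0, 0, 1, -z, 0, 0; 0, 0, 0, 1, 0, 0;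
        0, 0, 0, 0, 1, 0; 0, 0, 0, -w, 0, 1] := by
    ext I K
    fin_cases I <;> fin_cases K <;> simp [compound, pairs]
  rw [h, nullMat, nullMat]
  ext I K
  rw [Matrix.mul_apply, Fin.sum_univ_six]
  simp only [Matrix.mul_apply, Fin.sum_univ_six]
  fin_cases I <;> fin_cases K <;> simp <;> ring

theorem fresnelForm_nullMat_zero (s k t x y ν : ℝ) (ξ : Fin 4 → ℝ) :
    fresnelForm (nullMat s k t 0 0 x y - ν • pairJ) ξ =
      -(s * (s * ξ 1 ^ 2 - t * k * ξ 2 ^ 2 - 2 * t * ξ 0 * ξ 3) - t * x * ξ 0 ^ 2) *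
        (k * (s * ξ 1 ^ 2 - t * k * ξ 2 ^ 2 - 2 * t * ξ 0 * ξ 3) + y * ξ 0 ^ 2) := by
  have hV : (nullMat s k t 0 0 x y - ν • pairJ) * wedgeMat ξ = !![
      x * ξ 1, -x * ξ 0 - s * ξ 3, -ν * ξ 3, ν * ξ 2 + s * ξ 1;
      y * ξ 2, ν * ξ 3, -y * ξ 0 + t * k * ξ 3, -t * k * ξ 2 - ν * ξ 1;
      t * ξ 3, -ν * ξ 2, ν * ξ 1, -t * ξ 0;
      -ν * ξ 1 + t * k * ξ 2, ν * ξ 0, -t * k * ξ 0, 0;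
      s * ξ 1 - ν * ξ 2, -s * ξ 0, ν * ξ 0, 0;
      -ν * ξ 3, s * k * ξ 2, -s * k * ξ 1, ν * ξ 0] := by
    refine funext fun I => (mul_wedgeMat_eq _ ξ I).trans ?_
    ext a
    fin_cases I <;> fin_cases a <;> simp [nullMat, pairJ] <;> ring
  have hF : (wedgeMat ξ)ᵀ * ((nullMat s k t 0 0 x y - ν • pairJ) * wedgeMat ξ) = !![
      x * ξ 1 ^ 2 + y * ξ 2 ^ 2 + t * ξ 3 ^ 2, -x * ξ 0 * ξ 1 - s * ξ 1 * ξ 3,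
        t * k * ξ 2 * ξ 3 - y * ξ 0 * ξ 2, s * ξ 1 ^ 2 - t * k * ξ 2 ^ 2 - t * ξ 0 * ξ 3;
      -x * ξ 0 * ξ 1 - s * ξ 1 * ξ 3, 2 * s * ξ 0 * ξ 3 + x * ξ 0 ^ 2 + s * k * ξ 2 ^ 2,
        -s * k * ξ 1 * ξ 2, -s * ξ 0 * ξ 1;
      t * k * ξ 2 * ξ 3 - y * ξ 0 * ξ 2, -s * k * ξ 1 * ξ 2,
        -2 * t * k * ξ 0 * ξ 3 + y * ξ 0 ^ 2 + s * k * ξ 1 ^ 2, t * k * ξ 0 * ξ 2;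
      s * ξ 1 ^ 2 - t * k * ξ 2 ^ 2 - t * ξ 0 * ξ 3, -s * ξ 0 * ξ 1, t * k * ξ 0 * ξ 2,
        t * ξ 0 ^ 2] := by
    rw [hV, wedgeMat_eq]
    ext a c
    rw [Matrix.mul_apply, Fin.sum_univ_six]
    fin_cases a <;> fin_cases c <;> simp <;> ring
  rw [hV] at hF
  rw [fresnelForm_eq_of_mul_wedgeMat hV, hF]
  generalize ξ 0 = a, ξ 1 = b, ξ 2 = c, ξ 3 = d
  simp [Fin.sum_univ_four, asym, pairJ_mulVec]
  ring

theorem exists_eq_nullMat {X : Matrix (Fin 6) (Fin 6) ℝ} {l r : ℝ} (hX : X.IsSymm) (hl : 0 < l)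
    (hr : r ≠ 0) (h : X * pairJ * X = -l • pairJ + (vecMulVec (r • Pi.single 0 1) (Pi.single 1 1) +
      vecMulVec (Pi.single 1 1) (r • Pi.single 0 1))) :
    ∃ s k t z w x y, X = nullMat s k t z w x y ∧ t * k * s < 0 ∧ x * t * k + s * y ≠ 0 := by
  have hc := mul_pairJ_mulVec_comm hX h
  have hs : ∀ i j, X i j = X j i := fun i j => hX.apply j i
  have e₃ : pairJ *ᵥ (r • Pi.single 0 1 : Fin 6 → ℝ) = r • Pi.single 3 1 := by
    rw [pairJ_mulVec]
    ext i
    fin_cases i <;> simp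
  have e₄ : pairJ *ᵥ (Pi.single 1 1 : Fin 6 → ℝ) = Pi.single 4 1 := by
    rw [pairJ_mulVec]
    ext i
    fin_cases i <;> simp
  rw [e₃, e₄, Matrix.mulVec_smul, Matrix.mulVec_single_one, Matrix.mulVec_single_one] at hc
  have h₃ : ∀ i, i ≠ 0 → i ≠ 1 → X i 3 = 0 := fun i hi₀ hi₁ => by
    simpa [hi₀, hi₁, hr] using hc i 1
  have h₄ : ∀ i, i ≠ 0 → i ≠ 1 → X i 4 = 0 := fun i hi₀ hi₁ => by
    simpa [hi₀, hi₁, hr] using hc i 0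
  have h₁₄ : X 1 4 = X 0 3 := by
    simpa [hr, mul_comm] using hc 1 0
  have hq : ∀ I K, X 0 I * X 3 K + X 1 I * X 4 K + X 2 I * X 5 K + X 3 I * X 0 K + X 4 I * X 1 K +
      X 5 I * X 2 K = -l * pairJ I K + (r * (Pi.single 0 1 : Fin 6 → ℝ) I *
        (Pi.single 1 1 : Fin 6 → ℝ) K + (Pi.single 1 1 : Fin 6 → ℝ) I *
        (r * (Pi.single 0 1 : Fin 6 → ℝ) K)) := fun I K => by
    have := congrFun (congrFun h I) K
    rw [Matrix.mul_assoc, Matrix.mul_apply, Fin.sum_univ_six] at this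
    simp only [pairJ_mul_apply] at this
    rw [hs I 0, hs I 1, hs I 2, hs I 3, hs I 4, hs I 5] at this
    simpa [vecMulVec_apply, mul_assoc, mul_left_comm] using this
  have h₂₃ : X 2 3 = 0 := h₃ 2 (by decide) (by decide)
  have h₃₃ : X 3 3 = 0 := h₃ 3 (by decide) (by decide)
  have h₄₃ : X 4 3 = 0 := h₃ 4 (by decide) (by decide)
  have h₅₃ : X 5 3 = 0 := h₃ 5 (by decide) (by decide)
  have h₂₄ : X 2 4 = 0 := h₄ 2 (by decide) (by decide)
  have h₃₄ : X 3 4 = 0 := h₄ 3 (by decide) (by decide)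
  have h₄₄ : X 4 4 = 0 := h₄ 4 (by decide) (by decide)
  have h₅₄ : X 5 4 = 0 := h₄ 5 (by decide) (by decide)
  have q₀₃ := hq 0 3
  have q₀₄ := hq 0 4
  have q₁₃ := hq 1 3
  have q₂₂ := hq 2 2
  have q₅₅ := hq 5 5
  have q₂₅ := hq 2 5
  have q₀₂ := hq 0 2
  have q₀₅ := hq 0 5
  have q₀₀ := hq 0 0
  have q₀₁ := hq 0 1
  simp [pairJ, hs 3 0, hs 4 0, hs 3 1, hs 4 1, hs 3 2, hs 4 2, hs 3 5, hs 4 5, hs 1 0, hs 2 0,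
    hs 5 0, hs 2 1, hs 5 1, hs 5 2, h₁₄, h₂₃, h₃₃, h₄₃, h₅₃, h₂₄, h₃₄, h₄₄, h₅₄] 
    at q₀₃ q₀₄ q₁₃ q₂₂ q₅₅ q₂₅ q₀₂ q₀₅ q₀₀ q₀₁
  have p₀ : X 0 3 = 0 := by
    by_contra hp
    have h₀₄ : X 0 4 = 0 := (mul_eq_zero.1 (by linarith : X 0 3 * X 0 4 = 0)).resolve_left hp
    rw [h₀₄] at q₀₃
    nlinarith [mul_self_nonneg (X 0 3)]
  have p₁ : X 2 5 = 0 := by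
    by_contra hp
    have h₂₂ : X 2 2 = 0 := (mul_eq_zero.1 (by linarith : X 2 2 * X 2 5 = 0)).resolve_right hp
    rw [h₂₂] at q₂₅
    nlinarith [mul_self_nonneg (X 2 5)]
  rw [p₀] at q₀₃ q₀₂ q₀₅ q₀₀ q₀₁ h₁₄
  rw [p₁] at q₂₅ q₀₂ q₀₅
  have hs₀ : X 0 4 ≠ 0 := fun h₀ => by rw [h₀] at q₀₃; linarith
  have ht₀ : X 2 2 ≠ 0 := fun h₀ => by rw [h₀] at q₂₅; linarith
  have hk₀ : X 5 5 ≠ 0 := fun h₀ => by rw [h₀] at q₂₅; linarith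
  obtain ⟨k, hk⟩ : ∃ k, X 5 5 = X 0 4 * k := ⟨X 5 5 / X 0 4, by field_simp⟩
  obtain ⟨w, hw⟩ : ∃ w, X 0 2 = w * X 2 2 := ⟨X 0 2 / X 2 2, by field_simp⟩
  obtain ⟨z, hz⟩ : ∃ z, X 0 5 = z * X 0 4 * k :=
    ⟨X 0 5 / X 5 5, by rw [mul_assoc, ← hk]; field_simp⟩
  have h₁₃ : X 1 3 = X 2 2 * k := mul_left_cancel₀ hs₀ (by rw [hk] at q₂₅; linarith)
  have h₁₂ : X 1 2 = -z * X 2 2 * k :=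
    mul_left_cancel₀ hs₀ (by rw [hz] at q₀₂; linarith)
  have h₁₅ : X 1 5 = -w * X 2 2 * k :=
    mul_left_cancel₀ hs₀ (by rw [hw, hk] at q₀₅; linarith)
  have h₀₁ : X 0 1 = -w * z * X 2 2 * k :=
    mul_left_cancel₀ hs₀ (by rw [hw, hz] at q₀₀; linarith)
  refine ⟨X 0 4, k, X 2 2, z, w, X 0 0 - w ^ 2 * X 2 2 - z ^ 2 * X 0 4 * k, X 1 1, ?_, ?_, ?_⟩
  · ext I K
    fin_cases I <;> fin_cases K <;> simp [nullMat, hs 3 0, hs 4 0, hs 3 1, hs 4 1, hs 3 2, hs 4 2,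
      hs 3 5, hs 4 5, hs 1 0, hs 2 0, hs 5 0, hs 2 1, hs 5 1, hs 5 2, h₁₄, h₂₃, h₃₃, h₄₃, h₅₃,
      h₂₄, h₃₄, h₄₄, h₅₄, p₀, p₁, hk, hw, hz, h₁₃, h₁₂, h₁₅, h₀₁]
    ring
  · rw [hk] at q₂₅
    linarith
  · rw [h₁₃, h₁₅, hw, hz, h₁₂] at q₀₁
    contrapose! hr
    rw [← q₀₁]
    linear_combination hr

theorem fresnelForm_nullMat (s k t z w x y ν : ℝ) (ξ : Fin 4 → ℝ) :
    fresnelForm (nullMat s k t z w x y - ν • pairJ) ξ = fresnelForm (nullMat s k t 0 0 x y -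
      ν • pairJ) ((!![1, 0, -z, 0; 0, 1, 0, w; 0, 0, 1, 0; 0, 0, 0, 1] :
        Matrix (Fin 4) (Fin 4) ℝ)ᵀ *ᵥ ξ) := by
  have hdet : (!![1, 0, -z, 0; 0, 1, 0, w; 0, 0, 1, 0; 0, 0, 0, 1] :
      Matrix (Fin 4) (Fin 4) ℝ).det = 1 := by
    simp [Matrix.det_succ_row_zero, Fin.sum_univ_succ]
  have hJ := compound_mul_pairJ_mul_transpose
    !![1, 0, -z, 0; 0, 1, 0, w; 0, 0, 1, 0; 0, 0, 0, 1]
  rw [hdet, one_smul] at hJ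
  have hF := fresnelForm_compound !![1, 0, -z, 0; 0, 1, 0, w; 0, 0, 1, 0; 0, 0, 0, 1]
    (by rw [hdet]; exact isUnit_one) (nullMat s k t 0 0 x y - ν • pairJ) ξ
  rw [Matrix.mul_sub, Matrix.sub_mul, Matrix.mul_smul, Matrix.smul_mul, hJ,
    ← nullMat_eq_compound, hdet, one_pow, one_mul] at hF
  exact hF

theorem isDoubleCone_nullMat {s k t z w x y : ℝ} (h : t * k * s < 0) (hr : x * t * k + s * y ≠ 0)
    (ν : ℝ) : IsDoubleCone (fresnelForm (nullMat s k t z w x y - ν • pairJ)) := by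
  have hdet : (!![1, 0, -z, 0; 0, 1, 0, w; 0, 0, 1, 0; 0, 0, 0, 1] :
      Matrix (Fin 4) (Fin 4) ℝ).det = 1 := by
    simp [Matrix.det_succ_row_zero, Fin.sum_univ_succ]
  rw [show fresnelForm (nullMat s k t z w x y - ν • pairJ) = _ from
    funext (fresnelForm_nullMat s k t z w x y ν)]
  refine IsDoubleCone.comp_mulVec (F := fresnelForm (nullMat s k t 0 0 x y - ν • pairJ)) ?_
    (by rw [hdet]; exact isUnit_one)
  have hs : s ≠ 0 := by rintro rfl; simp at h
  have hk : k ≠ 0 := by rintro rfl; simp at h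
  have ht : t ≠ 0 := by rintro rfl; simp at h
  let Q : ℝ → ℝ → Matrix (Fin 4) (Fin 4) ℝ := fun p q =>
    !![q, 0, 0, -(p * t); 0, p * s, 0, 0; 0, 0, -(p * t * k), 0; -(p * t), 0, 0, 0]
  have hQ : ∀ p q, (Q p q).IsSymm := fun p q => by
    ext i j
    fin_cases i <;> fin_cases j <;> rfl
  have hQd : ∀ p q, p ≠ 0 → (Q p q).det < 0 := fun p q hp => by
    have e : (Q p q).det = (p ^ 2 * t) ^ 2 * (t * k * s) := by
      simp [Q, Matrix.det_succ_row_zero, Fin.sum_univ_succ, Fin.succAbove]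
      ring
    rw [e]
    exact mul_neg_of_pos_of_neg (by positivity) h
  have hQv : ∀ p q ξ, ξ ⬝ᵥ Q p q *ᵥ ξ =
      p * (s * ξ 1 ^ 2 - t * k * ξ 2 ^ 2 - 2 * t * ξ 0 * ξ 3) + q * ξ 0 ^ 2 := fun p q ξ => by
    simp [Q, Matrix.mulVec, dotProduct, Fin.sum_univ_four]
    ring
  refine ⟨Q s (-(t * x)), Q k y, hQ _ _, hQ _ _, hQd _ _ hs, hQd _ _ hk,
    ⟨![1, 0, 0, -x / (2 * s)], ?_, ?_⟩, fun ξ => ?_⟩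
  · rw [hQv]
    simp
    field_simp
    ring
  · rw [hQv]
    contrapose! hr
    simp at hr
    field_simp at hr
    linear_combination hr
  · rw [hQv, hQv, fresnelForm_nullMat_zero, mul_eq_zero, neg_eq_zero, neg_mul, sub_eq_add_neg]

/-- The direct sum of a form on a hyperbolic plane and the tensor product of two binary
quadratic forms, on the orthogonal complement of that plane. -/
def tensorMat (α β γ s₀ s₁ s₂ t₀ t₁ t₂ : ℝ) : Matrix (Fin 6) (Fin 6) ℝ :=
  !![γ, 0, 0, α, 0, 0;
    0, s₀ * t₀, s₀ * t₁, 0, -s₁ * t₁, s₁ * t₀;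
    0, s₀ * t₁, s₀ * t₂, 0, -s₁ * t₂, s₁ * t₁;
    α, 0, 0, β, 0, 0;
    0, -s₁ * t₁, -s₁ * t₂, 0, s₂ * t₂, -s₂ * t₁;
    0, s₁ * t₀, s₁ * t₁, 0, -s₂ * t₁, s₂ * t₀]

theorem fresnelForm_tensorMat (α β γ s₀ s₁ s₂ t₀ t₁ t₂ ν p q r h : ℝ) :
    fresnelForm (tensorMat α β γ s₀ s₁ s₂ t₀ t₁ t₂ - ν • pairJ) ![p, q, r, h] =
      γ * (t₀ * t₂ - t₁ ^ 2) * (s₀ * p ^ 2 + 2 * s₁ * p * q + s₂ * q ^ 2) ^ 2 +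
        ((s₀ * s₂ - s₁ ^ 2) * (t₀ * t₂ - t₁ ^ 2) + β * γ - α ^ 2) *
          (s₀ * p ^ 2 + 2 * s₁ * p * q + s₂ * q ^ 2) *
          (t₀ * r ^ 2 + 2 * t₁ * r * h + t₂ * h ^ 2) +
        β * (s₀ * s₂ - s₁ ^ 2) * (t₀ * r ^ 2 + 2 * t₁ * r * h + t₂ * h ^ 2) ^ 2 := by
  obtain ⟨u, hu⟩ : ∃ u, u = s₀ * p + s₁ * q := ⟨_, rfl⟩
  obtain ⟨v, hv⟩ : ∃ v, v = s₁ * p + s₂ * q := ⟨_, rfl⟩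
  obtain ⟨m, hm⟩ : ∃ m, m = t₀ * r + t₁ * h := ⟨_, rfl⟩
  obtain ⟨n, hn⟩ : ∃ n, n = t₁ * r + t₂ * h := ⟨_, rfl⟩
  obtain ⟨x, hx⟩ : ∃ x, x = p * u + q * v := ⟨_, rfl⟩
  obtain ⟨y, hy⟩ : ∃ y, y = r * m + h * n := ⟨_, rfl⟩
  obtain ⟨V, hV⟩ : ∃ V : Matrix (Fin 6) (Fin 4) ℝ, V = !![
      γ * q, -γ * p, (α - ν) * h, -(α - ν) * r;
      s₀ * m, s₁ * m + ν * h, -t₀ * u, -t₁ * u - ν * q;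
      s₀ * n, s₁ * n - ν * r, -t₁ * u + ν * q, -t₂ * u;
      (α - ν) * q, -(α - ν) * p, β * h, -β * r;
      -s₁ * n - ν * r, -s₂ * n, t₁ * v + ν * p, t₂ * v;
      s₁ * m - ν * h, s₂ * m, -t₀ * v, -t₁ * v + ν * p] := ⟨_, rfl⟩
  have hV' : (tensorMat α β γ s₀ s₁ s₂ t₀ t₁ t₂ - ν • pairJ) * wedgeMat ![p, q, r, h] = V := by
    refine funext fun I => (mul_wedgeMat_eq _ _ I).trans ?_
    ext a
    rw [hV, hu, hv, hm, hn]
    fin_cases I <;> fin_cases a <;> simp [tensorMat, pairJ] <;> ring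
  have hF : (wedgeMat ![p, q, r, h])ᵀ * V = !![
      γ * q ^ 2 + s₀ * y, -γ * p * q + s₁ * y, α * h * q - u * m, -α * q * r - u * n;
      -γ * p * q + s₁ * y, γ * p ^ 2 + s₂ * y, -α * h * p - v * m, α * p * r - v * n;
      α * h * q - u * m, -α * h * p - v * m, β * h ^ 2 + t₀ * x, -β * h * r + t₁ * x;
      -α * q * r - u * n, α * p * r - v * n, -β * h * r + t₁ * x, β * r ^ 2 + t₂ * x] := by
    rw [hV, wedgeMat_eq, hx, hy]
    ext a c
    rw [Matrix.mul_apply, Fin.sum_univ_six]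
    fin_cases a <;> fin_cases c <;> simp <;> subst hu hv hm hn <;> ring
  obtain ⟨e, he⟩ : ∃ e, e = α ^ 2 - 2 * α * ν + 3 * ν ^ 2 := ⟨_, rfl⟩
  obtain ⟨k, hk⟩ : ∃ k, k = -2 * α * ν + 3 * ν ^ 2 + β * γ +
    (s₀ * s₂ - s₁ ^ 2) * (t₀ * t₂ - t₁ ^ 2) := ⟨_, rfl⟩
  obtain ⟨T, hT⟩ : ∃ T : Matrix (Fin 4) (Fin 4) ℝ, T = !![
      e * p ^ 2 - 2 * β * s₂ * y - 2 * (t₀ * t₂ - t₁ ^ 2) * v ^ 2,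
        e * p * q + 2 * β * s₁ * y + 2 * (t₀ * t₂ - t₁ ^ 2) * u * v,
        k * p * r + 2 * α * v * n, k * p * h - 2 * α * v * m;
      e * p * q + 2 * β * s₁ * y + 2 * (t₀ * t₂ - t₁ ^ 2) * u * v,
        e * q ^ 2 - 2 * β * s₀ * y - 2 * (t₀ * t₂ - t₁ ^ 2) * u ^ 2,
        k * q * r - 2 * α * u * n, k * q * h + 2 * α * u * m;
      k * p * r + 2 * α * v * n, k * q * r - 2 * α * u * n,
        e * r ^ 2 - 2 * γ * t₂ * x - 2 * (s₀ * s₂ - s₁ ^ 2) * n ^ 2,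
        e * r * h + 2 * γ * t₁ * x + 2 * (s₀ * s₂ - s₁ ^ 2) * m * n;
      k * p * h - 2 * α * v * m, k * q * h + 2 * α * u * m,
        e * r * h + 2 * γ * t₁ * x + 2 * (s₀ * s₂ - s₁ ^ 2) * m * n,
        e * h ^ 2 - 2 * γ * t₀ * x - 2 * (s₀ * s₂ - s₁ ^ 2) * m ^ 2] := ⟨_, rfl⟩
  have hT' : ∀ a c, ∑ b, ∑ e, asym (pairJ *ᵥ V.col b) e a * asym (pairJ *ᵥ V.col e) b c =
      T a c := fun a c => by
    rw [hT, hV, he, hk, hx, hy]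
    fin_cases a <;> fin_cases c <;> simp [Fin.sum_univ_four, asym, pairJ_mulVec] <;>
      subst hu hv hm hn <;> ring
  simp only [fresnelForm_eq_of_mul_wedgeMat hV', hF, hT', hT]
  rw [he, hk, hx, hy, hu, hv, hm, hn]
  simp [Fin.sum_univ_four]
  ring

theorem exists_factorization {c₁ c₂ c₃ : ℝ} (h₁ : c₁ ≠ 0) (h₃ : c₃ ≠ 0)
    (hd : 0 < c₂ ^ 2 - 4 * c₁ * c₃) : ∃ u v, u ≠ v ∧ u ≠ 0 ∧ v ≠ 0 ∧
      ∀ x y, c₁ * x ^ 2 + c₂ * x * y + c₃ * y ^ 2 = c₁ * (x - u * y) * (x - v * y) := by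
  have hs := Real.sq_sqrt hd.le
  have hs₀ := Real.sqrt_pos.2 hd
  set δ := √(c₂ ^ 2 - 4 * c₁ * c₃)
  obtain ⟨u, hu⟩ : ∃ u, 2 * c₁ * u = -c₂ + δ := ⟨(-c₂ + δ) / (2 * c₁), by field_simp⟩
  obtain ⟨v, hv⟩ : ∃ v, 2 * c₁ * v = -c₂ - δ := ⟨(-c₂ - δ) / (2 * c₁), by field_simp⟩
  have hadd : c₁ * (u + v) = -c₂ := by linarith
  have hmul : c₁ * (u * v) = c₃ := mul_left_cancel₀ (mul_ne_zero four_ne_zero h₁) (by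
    linear_combination 2 * c₁ * v * hu + (-c₂ + δ) * hv - hs)
  refine ⟨u, v, fun e => ?_, fun e => h₃ ?_, fun e => h₃ ?_, fun x y => ?_⟩
  · rw [e] at hu
    linarith
  · rw [← hmul, e]
    ring
  · rw [← hmul, e]
    ring
  · linear_combination -y ^ 2 * hmul + x * y * hadd

theorem exists_binary_form_eq {s₀ s₁ s₂ : ℝ} (h : s₀ * s₂ - s₁ ^ 2 < 0) (c : ℝ) :
    ∃ p q, s₀ * p ^ 2 + 2 * s₁ * p * q + s₂ * q ^ 2 = c := by
  by_cases h₀ : s₀ = 0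
  · have h₁ : s₁ ≠ 0 := by
      rintro rfl
      simp [h₀] at h
    refine ⟨(c - s₂) / (2 * s₁), 1, ?_⟩
    rw [h₀]
    field_simp
    ring
  · have hd : 0 < s₁ ^ 2 - s₀ * s₂ := by linarith
    have hs := Real.sq_sqrt hd.le
    have hs₀ := (Real.sqrt_pos.2 hd).ne'
    set δ := √(s₁ ^ 2 - s₀ * s₂)
    obtain ⟨q, hq⟩ : ∃ q, 2 * δ * q = 1 - s₀ * c := ⟨(1 - s₀ * c) / (2 * δ), by field_simp⟩
    obtain ⟨p, hp⟩ : ∃ p, s₀ * p = 1 - δ * q - s₁ * q :=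
      ⟨(1 - δ * q - s₁ * q) / s₀, by field_simp⟩
    refine ⟨p, q, mul_left_cancel₀ h₀ ?_⟩
    linear_combination (s₀ * p + 1 - δ * q + s₁ * q) * hp + q ^ 2 * hs - hq

theorem isDoubleCone_tensorMat {α β γ s₀ s₁ s₂ t₀ t₁ t₂ ν l : ℝ} (hl : 0 < l)
    (hst : (s₀ * s₂ - s₁ ^ 2) * (t₀ * t₂ - t₁ ^ 2) = -l)
    (hd : 0 < (β * γ - α ^ 2 - l) ^ 2 + 4 * β * γ * l)
    (hF : NoPlane (fresnelForm (tensorMat α β γ s₀ s₁ s₂ t₀ t₁ t₂ - ν • pairJ))) :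
    IsDoubleCone (fresnelForm (tensorMat α β γ s₀ s₁ s₂ t₀ t₁ t₂ - ν • pairJ)) := by
  have hG := fresnelForm_tensorMat α β γ s₀ s₁ s₂ t₀ t₁ t₂ ν
  set F := fresnelForm (tensorMat α β γ s₀ s₁ s₂ t₀ t₁ t₂ - ν • pairJ)
  have hds : s₀ * s₂ - s₁ ^ 2 ≠ 0 := fun e => by rw [e] at hst; linarith
  have hdt : t₀ * t₂ - t₁ ^ 2 ≠ 0 := fun e => by rw [e] at hst; linarith
  have hγ : γ ≠ 0 := fun e => by
    obtain ⟨x, y, hxy⟩ := hF.exists_ne_zero (u := ![1, 0, 0, 0]) (v := ![0, 1, 0, 0])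
      (LinearIndependent.pair_iff.2 fun s t h => ⟨by simpa using congrFun h 0,
        by simpa using congrFun h 1⟩)
    refine hxy ?_
    rw [show x • ![1, 0, 0, 0] + y • ![0, 1, 0, 0] = ![x, y, 0, 0] by simp, hG, e]
    ring
  have hβ : β ≠ 0 := fun e => by
    obtain ⟨x, y, hxy⟩ := hF.exists_ne_zero (u := ![0, 0, 1, 0]) (v := ![0, 0, 0, 1])
      (LinearIndependent.pair_iff.2 fun s t h => ⟨by simpa using congrFun h 2,
        by simpa using congrFun h 3⟩)
    refine hxy ?_
    rw [show x • ![0, 0, 1, 0] + y • ![0, 0, 0, 1] = ![0, 0, x, y] by simp, hG, e]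
    ring
  obtain ⟨u, v, huv, hu, hv, hfac⟩ := exists_factorization (mul_ne_zero hγ hdt)
    (mul_ne_zero hβ hds) (c₂ := (s₀ * s₂ - s₁ ^ 2) * (t₀ * t₂ - t₁ ^ 2) + β * γ - α ^ 2) (by
      rw [hst]
      linear_combination hd + 4 * β * γ * hst)
  let Q : ℝ → Matrix (Fin 4) (Fin 4) ℝ := fun k => !![s₀, s₁, 0, 0; s₁, s₂, 0, 0;
    0, 0, -(k * t₀), -(k * t₁); 0, 0, -(k * t₁), -(k * t₂)]
  have hQ : ∀ k, (Q k).IsSymm := fun k => by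
    ext i j
    fin_cases i <;> fin_cases j <;> rfl
  have hQd : ∀ k, k ≠ 0 → (Q k).det < 0 := fun k hk => by
    have e : (Q k).det = k ^ 2 * ((s₀ * s₂ - s₁ ^ 2) * (t₀ * t₂ - t₁ ^ 2)) := by
      simp [Q, Matrix.det_succ_row_zero, Fin.sum_univ_succ, Fin.succAbove]
      ring
    rw [e, hst]
    exact mul_neg_of_pos_of_neg (by positivity) (neg_lt_zero.2 hl)
  have hQv : ∀ k p q r h, ![p, q, r, h] ⬝ᵥ Q k *ᵥ ![p, q, r, h] =
      (s₀ * p ^ 2 + 2 * s₁ * p * q + s₂ * q ^ 2) -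
        k * (t₀ * r ^ 2 + 2 * t₁ * r * h + t₂ * h ^ 2) := fun k p q r h => by
    simp [Q, Matrix.mulVec, dotProduct, Fin.sum_univ_four]
    ring
  obtain ⟨p, q, r, h, hpq, hrh⟩ : ∃ p q r h, s₀ * p ^ 2 + 2 * s₁ * p * q + s₂ * q ^ 2 =
      u * (t₀ * r ^ 2 + 2 * t₁ * r * h + t₂ * h ^ 2) ∧
        t₀ * r ^ 2 + 2 * t₁ * r * h + t₂ * h ^ 2 ≠ 0 := by
    rcases lt_or_gt_of_ne hds with hds | hds
    · have ht₀ : t₀ ≠ 0 := fun e => by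
        rw [e] at hst
        nlinarith [mul_nonneg (neg_nonneg.2 hds.le) (sq_nonneg t₁)]
      obtain ⟨p, q, hpq⟩ := exists_binary_form_eq hds (u * t₀)
      exact ⟨p, q, 1, 0, by rw [hpq]; ring, by simpa using ht₀⟩
    · have hdt : t₀ * t₂ - t₁ ^ 2 < 0 := by
        by_contra hn
        nlinarith [mul_nonneg hds.le (not_lt.1 hn)]
      have hs₀ : s₀ ≠ 0 := fun e => by
        rw [e] at hds
        nlinarith [sq_nonneg s₁]
      obtain ⟨r, h, hrh⟩ := exists_binary_form_eq hdt (s₀ / u)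
      refine ⟨1, 0, r, h, ?_, ?_⟩
      · rw [hrh]
        field_simp
        ring
      · rw [hrh]
        exact div_ne_zero hs₀ hu
  refine ⟨Q u, Q v, hQ u, hQ v, hQd u hu, hQd v hv, ⟨![p, q, r, h], ?_, ?_⟩, fun ξ => ?_⟩
  · rw [hQv, hpq, sub_self]
  · rw [hQv, hpq, ← sub_mul]
    exact mul_ne_zero (sub_ne_zero.2 huv) hrh
  · obtain ⟨p, q, r, h, rfl⟩ : ∃ p q r h, ξ = ![p, q, r, h] :=
      ⟨ξ 0, ξ 1, ξ 2, ξ 3, by ext i; fin_cases i <;> rfl⟩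
    rw [hG, hfac, hQv, hQv, mul_eq_zero, mul_eq_zero, or_iff_right (mul_ne_zero hγ hdt)]

theorem exists_eq_mul_of_minors {ι κ : Type*} {M : ι → κ → ℝ}
    (h : ∀ i j k l, M i k * M j l = M i l * M j k) :
    ∃ (u : ι → ℝ) (v : κ → ℝ), ∀ i k, M i k = u i * v k := by
  by_cases h₀ : ∀ i k, M i k = 0
  · exact ⟨0, 0, fun i k => by simp [h₀]⟩
  · push Not at h₀
    obtain ⟨i, k, hik⟩ := h₀
    refine ⟨fun j => M j k, fun l => M i l / M i k, fun j l => ?_⟩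
    field_simp
    linear_combination h i j k l

/-- A block-form statement that solutions of `K ^ 2 = -l` built from symmetric blocks are
trace-free. -/
theorem add_eq_zero_of_sq_eq_neg {p₀ p₁ p₂ a b c d r₀ r₁ r₂ l : ℝ} (hl : 0 < l)
    (h₁₁ : p₀ * a + p₁ * b = 0) (h₂₂ : p₁ * c + p₂ * d = 0)
    (h₁₂ : p₀ * c + a * p₁ + p₁ * d + b * p₂ = 0)
    (h₁₄ : p₀ * r₀ + a ^ 2 + p₁ * r₁ + b * c = -l)
    (h₂₅ : p₁ * r₁ + c * b + p₂ * r₂ + d ^ 2 = -l)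
    (h₁₅ : p₀ * r₁ + a * b + p₁ * r₂ + b * d = 0)
    (h₂₄ : p₁ * r₀ + c * a + p₂ * r₁ + d * c = 0) : a + d = 0 := by
  by_contra hT
  have e₁₂ : a * p₁ + b * p₂ = 0 := (mul_eq_zero.1 (by
    linear_combination a * h₁₂ + b * h₂₂ - c * h₁₁ : (a + d) * (a * p₁ + b * p₂) = 0)).resolve_left
      hT
  have e₂₁ : p₀ * c + p₁ * d = 0 := by linarith
  obtain ⟨T, hTd⟩ : ∃ T, T = a + d := ⟨_, rfl⟩
  obtain ⟨D, hD⟩ : ∃ D, D = a * d - b * c := ⟨_, rfl⟩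
  have k₁₁ : (T ^ 2 - D + l) * a = T * D := by
    subst hTd hD
    linear_combination a * h₁₄ + b * h₂₄ - r₀ * h₁₁ - r₁ * e₁₂
  have k₁₂ : (T ^ 2 - D + l) * b = 0 := by
    subst hTd hD
    linear_combination a * h₁₅ + b * h₂₅ - r₁ * h₁₁ - r₂ * e₁₂
  have k₂₁ : (T ^ 2 - D + l) * c = 0 := by
    subst hTd hD
    linear_combination c * h₁₄ + d * h₂₄ - r₀ * e₂₁ - r₁ * h₂₂
  have k₂₂ : (T ^ 2 - D + l) * d = T * D := by
    subst hTd hD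
    linear_combination c * h₁₅ + d * h₂₅ - r₁ * e₂₁ - r₂ * h₂₂
  rw [← hTd] at hT
  by_cases hE : T ^ 2 - D + l = 0
  · rw [hE, zero_mul, eq_comm, mul_eq_zero, or_iff_right hT] at k₁₁
    rw [k₁₁] at hE
    nlinarith [sq_nonneg T]
  · have hb := (mul_eq_zero.1 k₁₂).resolve_left hE
    have had : a = d := mul_left_cancel₀ hE (k₁₁.trans k₂₂.symm)
    rw [hb, zero_mul, sub_zero, had] at hD
    rw [had] at hTd
    have hd : d ≠ 0 := fun e => hT (by rw [hTd, e, add_zero])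
    subst hTd hD
    have : d ^ 2 + l = 0 := mul_left_cancel₀ hd (by linear_combination k₂₂)
    nlinarith [sq_nonneg d]

theorem exists_eq_tensorMat {X : Matrix (Fin 6) (Fin 6) ℝ} {l x y z w : ℝ} (hX : X.IsSymm)
    (hl : 0 < l) (hxw : x * w - y * z ≠ 0)
    (h : X * pairJ * X = -l • pairJ + (vecMulVec ![x, 0, 0, y, 0, 0] ![z, 0, 0, w, 0, 0] +
      vecMulVec ![z, 0, 0, w, 0, 0] ![x, 0, 0, y, 0, 0])) :
    ∃ α β γ s₀ s₁ s₂ t₀ t₁ t₂, X = tensorMat α β γ s₀ s₁ s₂ t₀ t₁ t₂ ∧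
      (s₀ * s₂ - s₁ ^ 2) * (t₀ * t₂ - t₁ ^ 2) = -l ∧
      0 < (β * γ - α ^ 2 - l) ^ 2 + 4 * β * γ * l := by
  have hc := mul_pairJ_mulVec_comm hX h
  have hs : ∀ i j, X i j = X j i := fun i j => hX.apply j i
  have hv : ∀ p q, X *ᵥ pairJ *ᵥ ![p, 0, 0, q, 0, 0] = fun i => X i 0 * q + X i 3 * p :=
    fun p q => by
      rw [pairJ_mulVec]
      ext i
      simp [Matrix.mulVec, dotProduct, Fin.sum_univ_six]
  rw [hv, hv] at hc
  have hcol : ∀ i, (![x, 0, 0, y, 0, 0] : Fin 6 → ℝ) i = 0 →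
      (![z, 0, 0, w, 0, 0] : Fin 6 → ℝ) i = 0 → X i 0 = 0 ∧ X i 3 = 0 := fun i hi hi' => by
    have h₀ := hc i 0
    have h₃ := hc i 3
    simp only [hi, hi', zero_mul, zero_add] at h₀ h₃
    simp at h₀ h₃
    have hD := pow_ne_zero 2 hxw
    refine ⟨(mul_eq_zero.1 ?_).resolve_right hD, (mul_eq_zero.1 ?_).resolve_right hD⟩
    · linear_combination z * (y * h₀ - x * h₃) + x * (w * h₀ - z * h₃)
    · linear_combination -w * (y * h₀ - x * h₃) - y * (w * h₀ - z * h₃)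
  have hq : ∀ I K, X 0 I * X 3 K + X 1 I * X 4 K + X 2 I * X 5 K + X 3 I * X 0 K + X 4 I * X 1 K +
      X 5 I * X 2 K = -l * pairJ I K + ((![x, 0, 0, y, 0, 0] : Fin 6 → ℝ) I *
        (![z, 0, 0, w, 0, 0] : Fin 6 → ℝ) K + (![z, 0, 0, w, 0, 0] : Fin 6 → ℝ) I *
        (![x, 0, 0, y, 0, 0] : Fin 6 → ℝ) K) := fun I K => by
    have := congrFun (congrFun h I) K
    rw [Matrix.mul_assoc, Matrix.mul_apply, Fin.sum_univ_six] at this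
    simp only [pairJ_mul_apply] at this
    rw [hs I 0, hs I 1, hs I 2, hs I 3, hs I 4, hs I 5] at this
    simp only [Matrix.add_apply, Matrix.smul_apply, vecMulVec_apply, smul_eq_mul] at this
    exact this
  obtain ⟨h₁₀, h₁₃⟩ := hcol 1 rfl rfl
  obtain ⟨h₂₀, h₂₃⟩ := hcol 2 rfl rfl
  obtain ⟨h₄₀, h₄₃⟩ := hcol 4 rfl rfl
  obtain ⟨h₅₀, h₅₃⟩ := hcol 5 rfl rfl
  have q₀₀ := hq 0 0
  have q₀₃ := hq 0 3
  have q₃₃ := hq 3 3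
  have q₁₁ := hq 1 1
  have q₂₂ := hq 2 2
  have q₁₂ := hq 1 2
  have q₄₄ := hq 4 4
  have q₅₅ := hq 5 5
  have q₄₅ := hq 4 5
  have q₁₄ := hq 1 4
  have q₂₅ := hq 2 5
  have q₁₅ := hq 1 5
  have q₂₄ := hq 2 4
  simp [pairJ, hs 3 0, hs 2 1, hs 4 1, hs 5 1, hs 4 2, hs 5 2, hs 5 4, hs 0 1, hs 0 2, hs 0 4,
    hs 0 5, hs 3 1, hs 3 2, hs 3 4, hs 3 5, h₁₀, h₁₃, h₂₀, h₂₃, h₄₀, h₄₃, h₅₀, h₅₃]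
    at q₀₀ q₀₃ q₃₃ q₁₁ q₂₂ q₁₂ q₄₄ q₅₅ q₄₅ q₁₄ q₂₅ q₁₅ q₂₄
  have htr : X 1 4 + X 2 5 = 0 := by
    apply add_eq_zero_of_sq_eq_neg (p₀ := X 1 1) (p₁ := X 1 2) (p₂ := X 2 2) (b := X 1 5)
      (c := X 2 4) (r₀ := X 4 4) (r₁ := X 4 5) (r₂ := X 5 5) hl <;> linarith
  have h₁₄ : X 1 4 = -X 2 5 := by linarith
  rw [h₁₄] at q₁₁ q₁₂ q₄₄ q₄₅ q₁₄ q₁₅ q₂₄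
  obtain ⟨σ, τ, hM⟩ := exists_eq_mul_of_minors (M := !![X 1 1, X 1 2, X 2 2;
    X 1 5, X 2 5, -X 2 4; X 5 5, -X 4 5, X 4 4]) (fun i j k l => by
      fin_cases i <;> fin_cases j <;> fin_cases k <;> fin_cases l <;> simp <;> linarith)
  have m₀₀ : X 1 1 = σ 0 * τ 0 := hM 0 0
  have m₀₁ : X 1 2 = σ 0 * τ 1 := hM 0 1
  have m₀₂ : X 2 2 = σ 0 * τ 2 := hM 0 2
  have m₁₀ : X 1 5 = σ 1 * τ 0 := hM 1 0
  have m₁₁ : X 2 5 = σ 1 * τ 1 := hM 1 1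
  have m₁₂ : X 2 4 = -(σ 1 * τ 2) := neg_eq_iff_eq_neg.1 (hM 1 2)
  have m₂₀ : X 5 5 = σ 2 * τ 0 := hM 2 0
  have m₂₁ : X 4 5 = -(σ 2 * τ 1) := neg_eq_iff_eq_neg.1 (hM 2 1)
  have m₂₂ : X 4 4 = σ 2 * τ 2 := hM 2 2
  refine ⟨X 0 3, X 3 3, X 0 0, σ 0, σ 1, σ 2, τ 0, τ 1, τ 2, ?_, ?_, ?_⟩
  · ext I K
    fin_cases I <;> fin_cases K <;> simp [tensorMat, hs 3 0, hs 2 1, hs 4 1, hs 5 1, hs 4 2,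
      hs 5 2, hs 5 4, hs 0 1, hs 0 2, hs 0 4, hs 0 5, hs 3 1, hs 3 2, hs 3 4, hs 3 5, h₁₀, h₁₃,
      h₂₀, h₂₃, h₄₀, h₄₃, h₅₀, h₅₃, h₁₄, m₀₀, m₀₁, m₀₂, m₁₀, m₁₁, m₁₂, m₂₀, m₂₁, m₂₂]
  · rw [m₀₀, m₀₁, m₁₀, m₁₁, m₁₂, m₂₁, m₂₂] at q₁₄
    linear_combination q₁₄
  · have e : (X 3 3 * X 0 0 - X 0 3 ^ 2 - l) ^ 2 + 4 * X 3 3 * X 0 0 * l =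
        (x * w - y * z) ^ 2 := by
      have e₀ : X 0 0 * X 0 3 = x * z := by linarith
      have e₃ : X 0 3 * X 3 3 = y * w := by linarith
      linear_combination (X 0 0 * X 3 3 + X 0 3 ^ 2 + l + x * w + z * y) * q₀₃ -
        4 * X 0 3 * X 3 3 * e₀ - 4 * x * z * e₃
    rw [e]
    positivity

theorem isDoubleCone_of_quadratic {X : Matrix (Fin 6) (Fin 6) ℝ} {a b : Fin 6 → ℝ} {l ν : ℝ}
    (hX : X.IsSymm) (hl : 0 < l) (ha : a ≠ 0) (hb : b ≠ 0)
    (h : X * pairJ * X = -l • pairJ + (vecMulVec a b + vecMulVec b a))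
    (hF : NoPlane (fresnelForm (X - ν • pairJ))) :
    IsDoubleCone (fresnelForm (X - ν • pairJ)) := by
  have hab := linearIndependent_of_quadratic hX hl ha hb h
  have key : ∀ L : Matrix (Fin 4) (Fin 4) ℝ, L.det ≠ 0 → ∀ a' b', a = compound L *ᵥ a' →
      b = compound L *ᵥ b' → (∀ (X' : Matrix (Fin 6) (Fin 6) ℝ) (ν' : ℝ), X'.IsSymm →
        X' * pairJ * X' = -(l / L.det ^ 2) • pairJ +
          (vecMulVec (L.det⁻¹ • a') b' + vecMulVec b' (L.det⁻¹ • a')) →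
        NoPlane (fresnelForm (X' - ν' • pairJ)) → IsDoubleCone (fresnelForm (X' - ν' • pairJ))) →
      IsDoubleCone (fresnelForm (X - ν • pairJ)) := by
    rintro L hL a' b' rfl rfl H
    obtain ⟨X', hX', h', e⟩ := exists_frame_matrix hL hX h ν
    have hd := pow_ne_zero 2 hL
    have hF' : NoPlane (fresnelForm (X' - (ν / L.det) • pairJ)) := by
      refine NoPlane.of_comp_mulVec hL.isUnit fun V hV hVF => hF V hV fun ξ hξ => ?_
      have := hVF hξ
      simp only [Set.mem_ofPred_eq] at this ⊢
      rw [e, this, mul_zero]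
    obtain ⟨P, M, hP, hM, hPd, hMd, hx, hPM⟩ :=
      (H X' (ν / L.det) hX' h' hF').comp_mulVec hL.isUnit
    refine ⟨P, M, hP, hM, hPd, hMd, hx, fun ξ => ?_⟩
    rw [e, mul_eq_zero, or_iff_right hd]
    exact hPM ξ
  rcases gram_neg_or_eq_zero hX hl hab h with hg | ⟨haa, hbb, hab'⟩
  · obtain ⟨L, hL, x, y, z, w, ha', hb', hxw⟩ := exists_frame_of_gram_neg hg
    refine key L hL _ _ ha' hb' fun X' ν' hX' h' hF' => ?_
    rw [show L.det⁻¹ • ![x, 0, 0, y, 0, 0] =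
      ![L.det⁻¹ * x, 0, 0, L.det⁻¹ * y, 0, 0] by simp] at h'
    have hxw' : L.det⁻¹ * x * w - L.det⁻¹ * y * z ≠ 0 := by
      rw [mul_assoc, mul_assoc, ← mul_sub]
      exact mul_ne_zero (inv_ne_zero hL) hxw
    have hl' : 0 < l / L.det ^ 2 := by positivity
    obtain ⟨α, β, γ, s₀, s₁, s₂, t₀, t₁, t₂, rfl, hst, hd⟩ :=
      exists_eq_tensorMat hX' hl' hxw' h'
    exact isDoubleCone_tensorMat hl' hst hd hF'
  · obtain ⟨L, hL, ha', hb'⟩ := exists_frame_of_gram_eq_zero hab haa hbb hab'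
    refine key L hL _ _ ha' hb' fun X' ν' hX' h' _ => ?_
    obtain ⟨s, k, t, z, w, x, y, rfl, hneg, hne⟩ :=
      exists_eq_nullMat hX' (by positivity) (inv_ne_zero hL) h'
    exact isDoubleCone_nullMat hneg hne ν'

/-- Main theorem, sufficiency: a skewon-free invertible medium tensor whose
Fresnel surface contains no 2-dimensional subspace and which satisfies
(κ + μ·Id)² = −λ·Id + ρ(Ā⊗B) + ρ(B̄⊗A) with λ > 0, ρ ≠ 0 and A, B nonzero
has a double light cone. -/
theorem stmt15 (κ : MT) (hanti : antisymMT κ) (hskew : adjT κ = κ)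
    (hinv : IsUnit (mat6 κ).det)
    (hnoplane : ∀ V : Submodule ℝ (Fin 4 → ℝ), Module.finrank ℝ V = 2 →
        ¬((V : Set (Fin 4 → ℝ)) ⊆ {ξ | fresnel κ ξ = 0}))
    (μ lam ρ : ℝ) (A B : BV) (hlam : 0 < lam) (hρ : ρ ≠ 0)
    (hA : antisymBV A) (hB : antisymBV B) (hA0 : A ≠ 0) (hB0 : B ≠ 0)
    (heq : compT (fun i j r s => κ i j r s + μ * idT i j r s)
          (fun i j r s => κ i j r s + μ * idT i j r s) =
        fun i j r s =>
          -lam * idT i j r s + tensAB ρ A B i j r s + tensAB ρ B A i j r s) :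
    ∃ gp gm, IsLorentz gp ∧ IsLorentz gm ∧ nullCone gp ≠ nullCone gm ∧
      {ξ | fresnel κ ξ = 0} = nullCone gp ∪ nullCone gm := by
  obtain ⟨X, a, b, hX, ha, hb, hq, hF⟩ := exists_symm_matrix hanti hskew hρ hA hB hA0 hB0 heq
  have e : fresnel κ = fresnelForm (X - μ • pairJ) := funext hF
  rw [e] at hnoplane ⊢
  exact (isDoubleCone_of_quadratic hX hlam ha hb hq hnoplane).exists_isLorentz
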